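/- arXiv:1711.02297 — 3 statements merged into one kernel-verified Lean document; each statement's English description precedes it below -/
import Mathlib

section
/- Let Γ = ⟨R_{-1}, R_0, ..., R_n⟩ be a generalized string C-group, and define for -1 ≤ i ≤ j ≤ n the relation Γ_i φ ≤ Γ_j ψ iff φψ^{-1} ∈ Γ_{i+1}^+ Γ_{j-1}^- on the right cosets of the subgroups Γ_i = ⟨R_k : k ≠ i⟩. Then this relation is a partial order on the disjoint union of the coset spaces. -/
open Set Pointwise

/-- The distinguished subgroup `Γ_I = ⟨R_i : i ∈ I⟩` of a group with a system of
generating subgroups `R : ℤ → Subgroup G` (with the convention `Γ_∅ = R_{-1}`,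
which is harmless for nonempty `I ⊆ {-1,…,n}` since `R_{-1}` is contained in
every `R_i`). -/
def GamI {G : Type*} [Group G] (R : ℤ → Subgroup G) (I : Set ℤ) : Subgroup G :=
  R (-1) ⊔ ⨆ i ∈ I, R i

/-- `Γ_k^- = ⟨R_j : j ≤ k⟩`. -/
def Gminus {G : Type*} [Group G] (R : ℤ → Subgroup G) (k : ℤ) : Subgroup G :=
  GamI R (Set.Icc (-1) k)

/-- `Γ_k^+ = ⟨R_j : j ≥ k⟩`. -/
def Gplus {G : Type*} [Group G] (R : ℤ → Subgroup G) (n k : ℤ) : Subgroup G :=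
  GamI R (Set.Icc k n)

/-- `Γ_i = ⟨R_j : j ≠ i⟩`. -/
def Gsub {G : Type*} [Group G] (R : ℤ → Subgroup G) (n i : ℤ) : Subgroup G :=
  GamI R (Set.Icc (-1) n \ {i})

/-- A generalized string C-group of rank `n`: a group generated by subgroups
`R_{-1}, R_0, …, R_n` with `R_{-1} = R_n` a proper subgroup of each `R_i`
(`0 ≤ i ≤ n-1`), satisfying the intersection property and the commutation rules
`R_i R_j = R_j R_i` (as product sets) for non-adjacent indices. -/
structure GenStringC {G : Type*} [Group G] (n : ℤ) (R : ℤ → Subgroup G) : Prop where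
  one_le_n : 1 ≤ n
  gen_top : GamI R (Set.Icc (-1) n) = ⊤
  ends_eq : R (-1) = R n
  ends_lt : ∀ i ∈ Set.Icc (0 : ℤ) (n - 1), R (-1) < R i
  inter : ∀ I J : Set ℤ, I ⊆ Set.Icc (-1 : ℤ) n → J ⊆ Set.Icc (-1 : ℤ) n →
    GamI R I ⊓ GamI R J = GamI R (I ∩ J)
  comm : ∀ i j : ℤ, -1 ≤ i → i < j - 1 → j ≤ n →
    (↑(R i) : Set G) * ↑(R j) = (↑(R j) : Set G) * ↑(R i)

/-- The set of `i`-faces of `K(Γ)`: right cosets of `Γ_i = ⟨R_k : k ≠ i⟩`. -/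
def Gface {G : Type*} [Group G] (n : ℤ) (R : ℤ → Subgroup G) (i : ℤ) :=
  Quotient (QuotientGroup.rightRel (Gsub R n i))

/-- The faces of the complex `K(Γ)`: for each rank `i ∈ {-1,…,n}` the right
cosets `Γ_i φ`. -/
def KF {G : Type*} [Group G] (n : ℤ) (R : ℤ → Subgroup G) :=
  Σ i : ↥(Set.Icc (-1 : ℤ) n), Gface n R i.1

/-- The incidence relation of `K(Γ)`:
`Γ_i φ ≤ Γ_j ψ  iff  i ≤ j and φψ⁻¹ ∈ Γ_{i+1}^+ Γ_{j-1}^-`. -/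
def KGle {G : Type*} [Group G] (n : ℤ) (R : ℤ → Subgroup G)
    (x y : KF n R) : Prop :=
  x.1.1 ≤ y.1.1 ∧ ∃ φ ψ : G,
    x.2 = Quotient.mk (QuotientGroup.rightRel (Gsub R n x.1.1)) φ ∧
    y.2 = Quotient.mk (QuotientGroup.rightRel (Gsub R n y.1.1)) ψ ∧
    φ * ψ⁻¹ ∈ (↑(Gplus R n (x.1.1 + 1)) : Set G) * ↑(Gminus R (y.1.1 - 1))

/-- Right multiplication action of `Γ` on the faces of `K(Γ)`. -/
def rmulKF {G : Type*} [Group G] (n : ℤ) (R : ℤ → Subgroup G) (g : G)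
    (x : KF n R) : KF n R :=
  ⟨x.1, Quotient.map (· * g)
    (fun a b h => by
      have h' : b * a⁻¹ ∈ Gsub R n x.1.1 :=
        (QuotientGroup.rightRel_apply).1 h
      refine (QuotientGroup.rightRel_apply).2 ?_
      simpa [mul_assoc] using h') x.2⟩

theorem aux_GamI_eq {G : Type*} [Group G] (R : ℤ → Subgroup G) (I : Set ℤ) :
    GamI R I = ⨆ i : ↥(insert (-1) I), R i.1 := by
  unfold GamI
  rw [← iSup_insert, iSup_subtype']

theorem aux_GamI_ind {G : Type*} [Group G] (R : ℤ → Subgroup G) (I : Set ℤ) (p : G → Prop)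
    (h0 : ∀ g ∈ R (-1), p g) (hI : ∀ i ∈ I, ∀ g ∈ R i, p g)
    (hm : ∀ a b, p a → p b → p (a * b)) {g : G} (hg : g ∈ GamI R I) : p g := by
  rw [aux_GamI_eq] at hg
  refine Subgroup.iSup_induction (C := p) _ hg ?_ (h0 1 (one_mem _)) hm
  rintro ⟨i, rfl | hi⟩ x hx
  · exact h0 x hx
  · exact hI i hi x hx

theorem aux_le_GamI {G : Type*} [Group G] (R : ℤ → Subgroup G) {I : Set ℤ} {i : ℤ}
    (hi : i ∈ I) : R i ≤ GamI R I :=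
  le_trans (le_biSup R hi) le_sup_right

theorem aux_GamI_mono {G : Type*} [Group G] (R : ℤ → Subgroup G) {I J : Set ℤ}
    (h : I ⊆ J) : GamI R I ≤ GamI R J :=
  sup_le_sup_left (biSup_mono h) _

def auxP {G : Type*} [Group G] (H K : Subgroup G) : Prop :=
  ∀ h ∈ H, ∀ k ∈ K, ∃ h' ∈ H, ∃ k' ∈ K, k * h = h' * k'

theorem auxP_symm {G : Type*} [Group G] {H K : Subgroup G} (hP : auxP H K) : auxP K H := by
  intro k hk h hh
  obtain ⟨h', hh', k', hk', e⟩ := hP h⁻¹ (inv_mem hh) k⁻¹ (inv_mem hk)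
  refine ⟨k'⁻¹, inv_mem hk', h'⁻¹, inv_mem hh', ?_⟩
  rw [← mul_inv_rev, ← e]; simp

theorem auxP_GamI {G : Type*} [Group G] {H : Subgroup G} (R : ℤ → Subgroup G) (I : Set ℤ)
    (h0 : auxP H (R (-1))) (hI : ∀ i ∈ I, auxP H (R i)) : auxP H (GamI R I) := by
  intro h hh k hk
  refine aux_GamI_ind R I
    (fun k => ∀ h ∈ H, ∃ h' ∈ H, ∃ k' ∈ GamI R I, k * h = h' * k') ?_ ?_ ?_ hk h hh
  · intro g hg h hh
    obtain ⟨h', hh', k', hk', e⟩ := h0 h hh g hg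
    exact ⟨h', hh', k', (le_sup_left : R (-1) ≤ GamI R I) hk', e⟩
  · intro i hi g hg h hh
    obtain ⟨h', hh', k', hk', e⟩ := hI i hi h hh g hg
    exact ⟨h', hh', k', aux_le_GamI R hi hk', e⟩
  · intro a b ha hb h hh
    obtain ⟨h', hh', k', hk', e⟩ := hb h hh
    obtain ⟨h2, hh2, k2, hk2, e2⟩ := ha h' hh'
    exact ⟨h2, hh2, k2 * k', mul_mem hk2 hk', by rw [mul_assoc, e, ← mul_assoc, e2, mul_assoc]⟩

theorem auxP_of_le {G : Type*} [Group G] {H K : Subgroup G} (h : K ≤ H) : auxP H K :=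
  fun x hx k hk => ⟨k * x, mul_mem (h hk) hx, 1, one_mem _, by simp⟩

theorem aux_bot {G : Type*} [Group G] {n : ℤ} {R : ℤ → Subgroup G} (hC : GenStringC n R)
    {i : ℤ} (h1 : -1 ≤ i) (h2 : i ≤ n) : R (-1) ≤ R i := by
  rcases eq_or_lt_of_le h1 with rfl | h1
  · exact le_rfl
  rcases eq_or_lt_of_le h2 with rfl | h2
  · exact hC.ends_eq.le
  exact (hC.ends_lt i ⟨by omega, by omega⟩).le

theorem aux_perm {G : Type*} [Group G] {n : ℤ} {R : ℤ → Subgroup G} (hC : GenStringC n R)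
    {j : ℤ} (h1 : -1 ≤ j) (h2 : j ≤ n) : auxP (Gplus R n (j + 1)) (Gminus R (j - 1)) := by
  refine auxP_GamI R _ (auxP_of_le le_sup_left) ?_
  rintro a ⟨ha1, ha2⟩
  refine auxP_symm (auxP_GamI R _ (auxP_of_le (aux_bot hC ha1 (by omega))) ?_)
  rintro b ⟨hb1, hb2⟩
  intro h hh k hk
  have : k * h ∈ (↑(R b) : Set G) * ↑(R a) := Set.mul_mem_mul hk hh
  rw [← hC.comm a b ha1 (by omega) hb2] at this
  obtain ⟨x, hx, y, hy, e⟩ := this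
  exact ⟨x, hx, y, hy, e.symm⟩

theorem aux_factor {G : Type*} [Group G] {n : ℤ} {R : ℤ → Subgroup G} (hC : GenStringC n R)
    {j : ℤ} (h1 : -1 ≤ j) (h2 : j ≤ n) {g : G} (hg : g ∈ Gsub R n j) :
    ∃ p ∈ Gplus R n (j + 1), ∃ q ∈ Gminus R (j - 1), g = p * q := by
  refine aux_GamI_ind R _
    (fun g => ∃ p ∈ Gplus R n (j + 1), ∃ q ∈ Gminus R (j - 1), g = p * q) ?_ ?_ ?_ hg
  · intro g hg
    exact ⟨g, (le_sup_left : R (-1) ≤ GamI R _) hg, 1, one_mem _, by simp⟩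
  · rintro i ⟨⟨hi1, hi2⟩, hij⟩ g hg
    have hij : i ≠ j := hij
    rcases lt_or_gt_of_ne hij with h | h
    · exact ⟨1, one_mem _, g, aux_le_GamI R (I := Set.Icc (-1) (j - 1)) ⟨hi1, by omega⟩ hg, by simp⟩
    · exact ⟨g, aux_le_GamI R (I := Set.Icc (j + 1) n) ⟨by omega, hi2⟩ hg, 1, one_mem _, by simp⟩
  · rintro a b ⟨p, hp, q, hq, rfl⟩ ⟨p', hp', q', hq', rfl⟩
    obtain ⟨x, hx, y, hy, e⟩ := aux_perm hC h1 h2 p' hp' q hq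
    refine ⟨p * x, mul_mem hp hx, y * q', mul_mem hy hq', ?_⟩
    calc p * q * (p' * q') = p * (q * p') * q' := by group
      _ = _ := by rw [e]; group

theorem aux_mk {G : Type*} [Group G] {n : ℤ} {R : ℤ → Subgroup G} {i : ℤ} {a b : G} :
    Quotient.mk (QuotientGroup.rightRel (Gsub R n i)) a =
      Quotient.mk (QuotientGroup.rightRel (Gsub R n i)) b ↔ b * a⁻¹ ∈ Gsub R n i := by
  rw [Quotient.eq, QuotientGroup.rightRel_apply]

theorem aux_plus_le {G : Type*} [Group G] {n : ℤ} (R : ℤ → Subgroup G) {i j : ℤ} (h1 : -1 ≤ i)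
    (h : i ≤ j) : Gplus R n (j + 1) ≤ Gsub R n i := by
  refine aux_GamI_mono R ?_
  rintro a ⟨ha, hb⟩
  refine ⟨⟨by omega, hb⟩, ?_⟩
  show a ≠ i
  omega

theorem aux_minus_le {G : Type*} [Group G] {n : ℤ} (R : ℤ → Subgroup G) {j k : ℤ} (h1 : k ≤ n)
    (h : j ≤ k) : Gminus R (j - 1) ≤ Gsub R n k := by
  refine aux_GamI_mono R ?_
  rintro a ⟨ha, hb⟩
  refine ⟨⟨ha, by omega⟩, ?_⟩
  show a ≠ k
  omega

/-- incidence means that the cosets meet -/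
theorem aux_KGle_iff {G : Type*} [Group G] {n : ℤ} {R : ℤ → Subgroup G} (x y : KF n R) :
    KGle n R x y ↔ x.1.1 ≤ y.1.1 ∧ ∃ a : G,
      x.2 = Quotient.mk (QuotientGroup.rightRel (Gsub R n x.1.1)) a ∧
      y.2 = Quotient.mk (QuotientGroup.rightRel (Gsub R n y.1.1)) a := by
  constructor
  · rintro ⟨hle, φ, ψ, hx, hy, p, hp, q, hq, e⟩
    have e : p * q = φ * ψ⁻¹ := e
    refine ⟨hle, q * ψ, hx.trans (aux_mk.2 ?_), hy.trans (aux_mk.2 ?_)⟩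
    · have : q * ψ * φ⁻¹ = p⁻¹ := by
        rw [eq_mul_inv_iff_mul_eq] at e
        rw [← e]; group
      rw [this]
      exact inv_mem (aux_plus_le R x.1.2.1 le_rfl hp)
    · rw [mul_inv_cancel_right]
      exact aux_minus_le R y.1.2.2 le_rfl hq
  · rintro ⟨hle, a, hx, hy⟩
    exact ⟨hle, a, a, hx, hy, 1, one_mem _, 1, one_mem _, by simp⟩

/-- for a generalized string C-group, the incidence relation on
the disjoint union of the right-coset spaces is a partial order. -/
theorem kgle_partial_order {G : Type*} [Group G]
    (n : ℤ) (R : ℤ → Subgroup G) (hC : GenStringC n R) :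
    (∀ x : KF n R, KGle n R x x) ∧
    (∀ x y : KF n R, KGle n R x y → KGle n R y x → x = y) ∧
    (∀ x y z : KF n R, KGle n R x y → KGle n R y z → KGle n R x z) := by
  refine ⟨?_, ?_, ?_⟩
  · intro x
    rw [aux_KGle_iff]
    obtain ⟨a, ha⟩ := Quotient.exists_rep x.2
    exact ⟨le_rfl, a, ha.symm, ha.symm⟩
  · rintro ⟨⟨i, hi⟩, x⟩ ⟨⟨j, hj⟩, y⟩ hxy hyx
    have hxy := (aux_KGle_iff _ _).1 hxy
    obtain ⟨h1, a, hx, hy⟩ := hxy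
    obtain rfl : i = j := le_antisymm h1 hyx.1
    have : x = y := hx.trans hy.symm
    rw [this]
  · intro x y z hxy hyz
    rw [aux_KGle_iff] at hxy hyz
    obtain ⟨h1, a, hx, hy⟩ := hxy
    obtain ⟨h2, b, hy', hz⟩ := hyz
    have hab := aux_mk.1 (hy'.symm.trans hy)
    obtain ⟨p, hp, q, hq, e⟩ := aux_factor hC y.1.2.1 y.1.2.2 hab
    rw [mul_inv_eq_iff_eq_mul] at e
    rw [aux_KGle_iff]
    refine ⟨h1.trans h2, q * b, hx.trans (aux_mk.2 ?_), hz.trans (aux_mk.2 ?_)⟩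
    · have : q * b * a⁻¹ = p⁻¹ := by rw [e]; group
      rw [this]
      exact inv_mem (aux_plus_le R x.1.2.1 h1 hp)
    · rw [mul_inv_cancel_right]
      exact aux_minus_le R z.1.2.2 h2 hq
end

section
/- Let K be a regular polytope complex of rank n (an incidence complex of rank n all of whose facets are abstract polytopes), with flag-transitive subgroup Γ = ⟨R_{-1}, R_0, ..., R_n⟩ and base flag {F_{-1},...,F_n}. Then R_{-1} is a normal subgroup of the facet stabilizer Γ_{n-1} = ⟨R_{-1}, R_0, ..., R_{n-2}⟩, it equals the kernel of the action of Γ_{n-1} on the base facet F_{n-1}/F_{-1}, and Γ_{n-1}/R_{-1} ≅ Aut(F_{n-1}/F_{-1}) is a string C-group. -/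
open Set Pointwise

/-- `Φ` is a flag of the subset `s` of the poset `α`: a chain contained in `s`
that is maximal among chains contained in `s`. -/
def IsFlagOf {α : Type*} [PartialOrder α] (s Φ : Set α) : Prop :=
  Φ ⊆ s ∧ IsChain (· ≤ ·) Φ ∧
    ∀ Ψ : Set α, Ψ ⊆ s → IsChain (· ≤ ·) Ψ → Φ ⊆ Ψ → Ψ = Φ

/-- Two flags are adjacent if each differs from the other in exactly one face. -/
def FlagAdj {α : Type*} [PartialOrder α] (Φ Ψ : Set α) : Prop :=
  (Φ \ Ψ).ncard = 1 ∧ (Ψ \ Φ).ncard = 1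

/-- The set `s` is flag-connected: any two flags of `s` are joined by a sequence
of successively adjacent flags of `s`. -/
def FlagConnIn {α : Type*} [PartialOrder α] (s : Set α) : Prop :=
  ∀ Φ Ψ : Set α, IsFlagOf s Φ → IsFlagOf s Ψ →
    Relation.ReflTransGen
      (fun A B => IsFlagOf s A ∧ IsFlagOf s B ∧ FlagAdj A B) Φ Ψ

/-- The section between `F` and `G` is connected: any two of its proper faces are
joined by a finite sequence of successively incident proper faces of the section. -/
def ConnIn {α : Type*} [PartialOrder α] (F G : α) : Prop :=
  ∀ H K : α, F < H → H < G → F < K → K < G →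
    Relation.ReflTransGen
      (fun a b => F < a ∧ a < G ∧ F < b ∧ b < G ∧ (a ≤ b ∨ b ≤ a)) H K

/-- An incidence complex of rank `n`: a bounded ranked poset (rank function `rk`
with range `{-1,…,n}`, strictly monotone, all flags having `n+2` elements hitting
every rank), strongly connected (I3), and with at least two `i`-faces between any
incident pair of faces of ranks `i-1` and `i+1` (I4). -/
structure IncComplex (α : Type*) [PartialOrder α] [BoundedOrder α]
    (n : ℤ) (rk : α → ℤ) : Prop where
  rk_bot : rk (⊥ : α) = -1
  rk_top : rk (⊤ : α) = n
  rk_strictMono : ∀ a b : α, a < b → rk a < rk b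
  chain_flag : ∀ c : Set α, IsChain (· ≤ ·) c →
    ∃ Φ : Set α, c ⊆ Φ ∧ IsFlagOf Set.univ Φ ∧ Φ.ncard = (n + 2).toNat
  flag_rk : ∀ Φ : Set α, IsFlagOf Set.univ Φ →
    ∀ i ∈ Set.Icc (-1 : ℤ) n, ∃ a ∈ Φ, rk a = i
  strong_conn : ∀ F G : α, F ≤ G → 2 ≤ rk G - rk F - 1 → ConnIn F G
  two_between : ∀ F G : α, F < G → rk G = rk F + 2 →
    ∃ H H' : α, H ≠ H' ∧ F < H ∧ H < G ∧ F < H' ∧ H' < G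

/-- A complex is regular if its automorphism group acts transitively on flags. -/
def IsRegularIC (α : Type*) [PartialOrder α] : Prop :=
  ∀ Φ Ψ : Set α, IsFlagOf Set.univ Φ → IsFlagOf Set.univ Ψ →
    ∃ g : α ≃o α, ⇑g '' Φ = Ψ

/-- `Γ` is a flag-transitive subgroup of the automorphism group. -/
def FlagTrans {α : Type*} [PartialOrder α] (Γ : Subgroup (α ≃o α)) : Prop :=
  ∀ Φ Ψ : Set α, IsFlagOf Set.univ Φ → IsFlagOf Set.univ Ψ →
    ∃ g ∈ Γ, ⇑g '' Φ = Ψ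

/-- The distinguished generating subset `R_i`: the stabilizer in `Γ` of
`Φ \ {F_i}`, where `F` enumerates the base flag by rank. -/
def Rset {α : Type*} [PartialOrder α] (Γ : Subgroup (α ≃o α)) (F : ℤ → α)
    (n i : ℤ) : Set (α ≃o α) :=
  {g | g ∈ Γ ∧ ∀ j ∈ Set.Icc (-1 : ℤ) n, j ≠ i → g (F j) = F j}

/-- The flag stabilizer `R_{-1} = Γ_Φ` of the base flag. -/
def FlagStab {α : Type*} [PartialOrder α] (Γ : Subgroup (α ≃o α)) (F : ℤ → α)
    (n : ℤ) : Set (α ≃o α) :=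
  {g | g ∈ Γ ∧ ∀ j ∈ Set.Icc (-1 : ℤ) n, g (F j) = F j}

/-- The facet stabilizer `Γ_{n-1} = ⟨R_{-1}, R_0, …, R_{n-2}⟩`. -/
def FacetStab {α : Type*} [PartialOrder α] (Γ : Subgroup (α ≃o α)) (F : ℤ → α)
    (n : ℤ) : Subgroup (α ≃o α) :=
  Subgroup.closure (⋃ i ∈ Set.Icc (-1 : ℤ) (n - 2), Rset Γ F n i)

namespace PCFA

def IsFl {β : Type*} [PartialOrder β] (m : ℤ) (rk : β → ℤ) (c : ℤ → β) : Prop :=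
  Monotone c ∧ ∀ i, rk (c i) = max (-1) (min i m)

structure Pre (β : Type*) [PartialOrder β] [BoundedOrder β] (m : ℤ) (rk : β → ℤ) : Prop where
  hm : 0 ≤ m
  rbot : rk (⊥ : β) = -1
  rtop : rk (⊤ : β) = m
  smono : ∀ a b : β, a < b → rk a < rk b
  ext : ∀ s : Set β, IsChain (· ≤ ·) s → ∃ c, IsFl m rk c ∧ s ⊆ range c

structure Poly (β : Type*) [PartialOrder β] [BoundedOrder β] (m : ℤ) (rk : β → ℤ) : Prop
    extends Pre β m rk where
  conn : ∀ F G : β, F ≤ G → 2 ≤ rk G - rk F - 1 → ConnIn F G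
  diam : ∀ A B : β, A < B → rk B = rk A + 2 → {H : β | A < H ∧ H < B}.ncard = 2

section
variable {β : Type*} [PartialOrder β] [BoundedOrder β] {m : ℤ} {rk : β → ℤ}

theorem Pre.eq_of_le (h : Pre β m rk) {x y : β} (hxy : x ≤ y) (hr : rk x = rk y) : x = y := by
  by_contra hne
  have := h.smono x y (lt_of_le_of_ne hxy hne)
  omega

theorem Pre.mono (h : Pre β m rk) {x y : β} (hxy : x ≤ y) : rk x ≤ rk y := by
  rcases eq_or_lt_of_le hxy with rfl | h1
  · exact le_rfl
  · exact (h.smono x y h1).le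

theorem Pre.lb (h : Pre β m rk) (x : β) : -1 ≤ rk x := by
  have := h.mono (bot_le (a := x)); rw [h.rbot] at this; exact this

theorem Pre.ub (h : Pre β m rk) (x : β) : rk x ≤ m := by
  have := h.mono (le_top (a := x)); rw [h.rtop] at this; exact this

theorem Pre.fl_inj (h : Pre β m rk) {e : ℤ → β} (he : IsFl m rk e) {i j : ℤ}
    (hr : rk (e i) = rk (e j)) : e i = e j := by
  rcases le_total i j with hij | hij
  · exact h.eq_of_le (he.1 hij) hr
  · exact (h.eq_of_le (he.1 hij) hr.symm).symm

theorem Pre.fl_of_mem (h : Pre β m rk) {e : ℤ → β} (he : IsFl m rk e) {x : β}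
    (hx : x ∈ range e) {i : ℤ} (hr : rk x = max (-1) (min i m)) : e i = x := by
  obtain ⟨k, rfl⟩ := hx
  apply h.fl_inj he
  rw [he.2 i, hr]

theorem Pre.fl_rk (h : Pre β m rk) {e : ℤ → β} (he : IsFl m rk e) {x : β}
    (hx : x ∈ range e) : e (rk x) = x := by
  apply h.fl_of_mem he hx
  have := h.lb x; have := h.ub x
  omega

theorem Pre.fl_out (h : Pre β m rk) {c d : ℤ → β} (hc : IsFl m rk c) (hd : IsFl m rk d) {i : ℤ}
    (hi : i ∉ Finset.Icc 0 (m-1)) : c i = d i := by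
  have hm := h.hm
  have h1 := hc.2 i
  have h2 := hd.2 i
  simp only [Finset.mem_Icc, not_and_or, not_le] at hi
  rcases hi with hi | hi
  · have e1 : (⊥ : β) = c i := h.eq_of_le bot_le (by rw [h.rbot]; omega)
    have e2 : (⊥ : β) = d i := h.eq_of_le bot_le (by rw [h.rbot]; omega)
    rw [← e1, ← e2]
  · have e1 : c i = (⊤ : β) := h.eq_of_le le_top (by rw [h.rtop]; omega)
    have e2 : d i = (⊤ : β) := h.eq_of_le le_top (by rw [h.rtop]; omega)
    rw [e1, e2]

theorem Pre.fl_lt (h : Pre β m rk) {c : ℤ → β} (hc : IsFl m rk c) {i j : ℤ}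
    (hi : -1 ≤ i) (hij : i < j) (hj : j ≤ m) : c i < c j := by
  refine lt_of_le_of_ne (hc.1 hij.le) ?_
  intro he
  have h1 := hc.2 i
  have h2 := hc.2 j
  rw [he] at h1
  omega

theorem Pre.rank_le (h : Pre β m rk) (φ : β ≃o β) (x : β) : rk x ≤ rk (φ x) := by
  obtain ⟨c, hc, hx⟩ := h.ext {x} (by simp [IsChain])
  have hx' := h.fl_rk hc (hx rfl)
  have key : ∀ i : ℤ, -1 ≤ i → i ≤ m → i ≤ rk (φ (c i)) := by
    intro i hi
    induction i, hi using Int.leInduction with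
    | base => intro _; exact h.lb _
    | succ k hk ih =>
      intro hkm
      have := ih (by omega)
      have h2 := h.smono _ _ (φ.strictMono (h.fl_lt hc hk (show k < k + 1 by omega) hkm))
      omega
  have := key (rk x) (h.lb x) (h.ub x)
  rwa [hx'] at this

theorem Pre.rank_eq (h : Pre β m rk) (φ : β ≃o β) (x : β) : rk (φ x) = rk x := by
  apply le_antisymm _ (h.rank_le φ x)
  have := h.rank_le φ.symm (φ x)
  simpa using this

theorem Pre.fl_map (h : Pre β m rk) (φ : β ≃o β) {c : ℤ → β} (hc : IsFl m rk c) :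
    IsFl m rk (fun i => φ (c i)) :=
  ⟨fun _ _ hij => φ.monotone (hc.1 hij), fun i => by rw [h.rank_eq]; exact hc.2 i⟩

def Adj (m : ℤ) (rk : β → ℤ) (J : Finset ℤ) (c d : ℤ → β) : Prop :=
  IsFl m rk c ∧ IsFl m rk d ∧ ∃ i ∈ J, ∀ j, j ≠ i → c j = d j

theorem Adj.mono {J J' : Finset ℤ} (hJ : J ⊆ J') {c d : ℤ → β}
    (h : Relation.ReflTransGen (Adj m rk J) c d) : Relation.ReflTransGen (Adj m rk J') c d := by
  refine Relation.ReflTransGen.mono ?_ _ _ h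
  rintro a b ⟨h1, h2, i, hi, h3⟩
  exact ⟨h1, h2, i, hJ hi, h3⟩

theorem Poly.connected (h : Poly β m rk) (J : Finset ℤ) (hJ : J ⊆ Finset.Icc 0 (m-1)) :
    ∀ c d : ℤ → β, IsFl m rk c → IsFl m rk d → (∀ i, i ∉ J → c i = d i) →
      Relation.ReflTransGen (Adj m rk J) c d := by
  induction J using Finset.strongInduction with
  | H J IH =>
  intro c d hc hd hcd
  rcases J.eq_empty_or_nonempty with rfl | hne
  · have : c = d := funext fun i => hcd i (by simp)
    rw [this]
  by_cases hgap : ∃ g, g ∉ J ∧ (∃ a ∈ J, a < g) ∧ (∃ b ∈ J, g < b)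
  · obtain ⟨g, hg, ⟨a, ha, hag⟩, ⟨b, hb, hgb⟩⟩ := hgap
    have hcg := hcd g hg
    have hs1 : J.filter (· < g) ⊂ J := by
      refine (Finset.ssubset_iff_of_subset (Finset.filter_subset _ _)).2 ⟨b, hb, ?_⟩
      simp; omega
    have hs2 : J.filter (g < ·) ⊂ J := by
      refine (Finset.ssubset_iff_of_subset (Finset.filter_subset _ _)).2 ⟨a, ha, ?_⟩
      simp; omega
    let e : ℤ → β := fun i => if i ≤ g then d i else c i
    have he : IsFl m rk e := by
      constructor
      · intro i j hij
        simp only [e]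
        split_ifs with h1 h2 h2
        · exact hd.1 hij
        · exact (hd.1 h1).trans (hcg ▸ hc.1 (by omega))
        · omega
        · exact hc.1 hij
      · intro i
        simp only [e]
        split_ifs
        · exact hd.2 i
        · exact hc.2 i
    have p1 := IH _ hs1 (hs1.subset.trans hJ) c e hc he (by
      intro i hi
      simp only [e]
      split_ifs with h1
      · rcases eq_or_lt_of_le h1 with rfl | h2
        · exact hcg
        · apply hcd
          intro hiJ; exact hi (by simp [hiJ, h2])
      · rfl)
    have p2 := IH _ hs2 (hs2.subset.trans hJ) e d he hd (by
      intro i hi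
      simp only [e]
      split_ifs with h1
      · rfl
      · apply hcd
        intro hiJ; exact hi (by simp [hiJ]; omega))
    exact (Adj.mono hs1.subset p1).trans (Adj.mono hs2.subset p2)
  · push Not at hgap
    set a := J.min' hne - 1 with ha
    set b := J.max' hne + 1 with hb
    have hminJ := J.min'_mem hne
    have hmaxJ := J.max'_mem hne
    have hmem : ∀ i, i ∈ J ↔ a < i ∧ i < b := by
      intro i
      constructor
      · intro hi
        have := J.min'_le i hi
        have := J.le_max' i hi
        omega
      · rintro ⟨h1, h2⟩
        by_contra hi
        have := hgap i hi ⟨_, hminJ, lt_of_le_of_ne (by omega) (by rintro h; exact hi (h ▸ hminJ))⟩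
          _ hmaxJ
        have : J.max' hne = i := by omega
        exact hi (this ▸ hmaxJ)
    have hminI := Finset.mem_Icc.1 (hJ hminJ)
    have hmaxI := Finset.mem_Icc.1 (hJ hmaxJ)
    have hminmax := J.min'_le _ hmaxJ
    have hra := hc.2 a
    have hrb := hc.2 b
    by_cases hlen : b = a + 2
    · refine Relation.ReflTransGen.single ⟨hc, hd, _, hminJ, ?_⟩
      intro j hj
      apply hcd
      rw [hmem]; omega
    have hconn := h.conn (c a) (c b) (hc.1 (by omega)) (by omega)
    have key : ∀ (H : β), c a < H → H < c b → ∀ c' d', IsFl m rk c' → IsFl m rk d' →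
        (∀ i, i ∉ J → c' i = c i) → (∀ i, i ∉ J → d' i = c i) → H ∈ range c' → H ∈ range d' →
        Relation.ReflTransGen (Adj m rk J) c' d' := by
      intro H h1 h2 c' d' hc' hd' hcc hdd hH hH'
      have r1 := h.smono _ _ h1
      have r2 := h.smono _ _ h2
      have hr : rk H ∈ J := by rw [hmem]; omega
      have hss := Finset.erase_ssubset hr
      refine Adj.mono hss.subset (IH _ hss (hss.subset.trans hJ) c' d' hc' hd' ?_)
      intro i hi
      by_cases hi' : i = rk H
      · subst hi'
        rw [h.fl_rk hc' hH, h.fl_rk hd' hH']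
      · have : i ∉ J := fun hJ => hi (Finset.mem_erase.2 ⟨hi', hJ⟩)
        rw [hcc i this, hdd i this]
    have hext : ∀ K L : β, c a < K → K < c b → c a < L → L < c b → (K ≤ L ∨ L ≤ K) →
        ∃ e, IsFl m rk e ∧ (∀ i, i ∉ J → e i = c i) ∧ K ∈ range e ∧ L ∈ range e := by
      intro K L hK1 hK2 hL1 hL2 hKL
      have aux : ∀ M : β, c a < M → M < c b → ∀ i, i ∉ J → M ≤ c i ∨ c i ≤ M := by
        intro M h1 h2 i hi
        rw [hmem] at hi
        by_cases hia : i ≤ a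
        · right; exact (hc.1 hia).trans h1.le
        · left; exact h2.le.trans (hc.1 (by omega))
      have hch : IsChain (· ≤ ·) (insert K (insert L (c '' {i | i ∉ J}))) := by
        refine IsChain.insert (IsChain.insert ?_ ?_) ?_
        · rintro _ ⟨i, _, rfl⟩ _ ⟨j, _, rfl⟩ _
          rcases le_total i j with hij | hij
          · left; exact hc.1 hij
          · right; exact hc.1 hij
        · rintro _ ⟨i, hi, rfl⟩ _
          exact aux L hL1 hL2 i hi
        · rintro _ (rfl | ⟨i, hi, rfl⟩) _
          · exact hKL
          · exact aux K hK1 hK2 i hi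
      obtain ⟨e, he, hs⟩ := h.ext _ hch
      refine ⟨e, he, ?_, hs (by simp), hs (by simp)⟩
      intro i hi
      exact h.fl_of_mem he (hs (by right; right; exact ⟨i, hi, rfl⟩)) (hc.2 i)
    have hpath : ∀ H K, Relation.ReflTransGen
        (fun x y => c a < x ∧ x < c b ∧ c a < y ∧ y < c b ∧ (x ≤ y ∨ y ≤ x)) H K →
        c a < H → H < c b → ∀ c' d', IsFl m rk c' → IsFl m rk d' →
        (∀ i, i ∉ J → c' i = c i) → (∀ i, i ∉ J → d' i = c i) → H ∈ range c' → K ∈ range d' →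
        Relation.ReflTransGen (Adj m rk J) c' d' := by
      intro H K hHK hH1 hH2
      induction hHK with
      | refl => exact key H hH1 hH2
      | tail _ hst ih =>
        intro c' d' hc' hd' hcc hdd hH hL
        obtain ⟨k1, k2, l1, l2, hkl⟩ := hst
        obtain ⟨e, he, hee, hKe, hLe⟩ := hext _ _ k1 k2 l1 l2 hkl
        exact (ih c' e hc' he hcc hee hH hKe).trans (key _ l1 l2 e d' he hd' hee hdd hLe hL)
    have hda : d a = c a := (hcd a (by rw [hmem]; omega)).symm
    have hdb : d b = c b := (hcd b (by rw [hmem]; omega)).symm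
    have c1 : c a < c (a+1) := h.fl_lt hc (by omega) (by omega) (by omega)
    have c2 : c (a+1) < c b := h.fl_lt hc (by omega) (by omega) (by omega)
    have d1 : c a < d (a+1) := hda ▸ h.fl_lt hd (by omega) (by omega) (by omega)
    have d2 : d (a+1) < c b := hdb ▸ h.fl_lt hd (by omega) (by omega) (by omega)
    exact hpath _ _ (hconn _ _ c1 c2 d1 d2) c1 c2 c d hc hd (fun _ _ => rfl)
      (fun i hi => (hcd i hi).symm) ⟨_, rfl⟩ ⟨_, rfl⟩

theorem Poly.dia (h : Poly β m rk) {c d d' : ℤ → β} (hc : IsFl m rk c) (hd : IsFl m rk d)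
    (hd' : IsFl m rk d') {i : ℤ} (hi : i ∈ Finset.Icc 0 (m-1))
    (h1 : d (i-1) = c (i-1)) (h2 : d (i+1) = c (i+1))
    (h1' : d' (i-1) = c (i-1)) (h2' : d' (i+1) = c (i+1)) :
    d i = c i ∨ d' i = c i ∨ d i = d' i := by
  rw [Finset.mem_Icc] at hi
  have r1 := hc.2 (i-1)
  have r2 := hc.2 (i+1)
  have hn := h.diam (c (i-1)) (c (i+1)) (h.fl_lt hc (by omega) (by omega) (by omega)) (by omega)
  obtain ⟨x, y, hxy, hs⟩ := Set.ncard_eq_two.1 hn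
  have m1 : c i ∈ ({x, y} : Set β) := hs ▸ ⟨h.fl_lt hc (by omega) (by omega) (by omega),
    h.fl_lt hc (by omega) (by omega) (by omega)⟩
  have m2 : d i ∈ ({x, y} : Set β) := hs ▸ ⟨h1 ▸ h.fl_lt hd (by omega) (by omega) (by omega),
    h2 ▸ h.fl_lt hd (by omega) (by omega) (by omega)⟩
  have m3 : d' i ∈ ({x, y} : Set β) := hs ▸ ⟨h1' ▸ h.fl_lt hd' (by omega) (by omega) (by omega),
    h2' ▸ h.fl_lt hd' (by omega) (by omega) (by omega)⟩
  simp only [Set.mem_insert_iff, Set.mem_singleton_iff] at m1 m2 m3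
  grind

theorem Poly.rigid (h : Poly β m rk) {F : ℤ → β} (hF : IsFl m rk F) (φ : β ≃o β)
    (hφ : ∀ j, φ (F j) = F j) : φ = 1 := by
  ext x
  obtain ⟨c, hc, hx⟩ := h.ext {x} (by simp [IsChain])
  obtain ⟨k, rfl⟩ := hx rfl
  have hp := h.connected (Finset.Icc 0 (m-1)) (Finset.Subset.refl _) F c hF hc
    (fun i hi => h.fl_out hF hc hi)
  suffices ∀ j, φ (c j) = c j from this k
  clear hx hc
  induction hp with
  | refl => exact hφ
  | tail _ hst ih =>
    rename_i c d _
    obtain ⟨hc, hd, i, hi, hcd⟩ := hst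
    intro j
    by_cases hj : j = i
    · subst hj
      rcases h.dia hc hd (h.fl_map φ hd) hi (hcd _ (by omega)).symm (hcd _ (by omega)).symm
        (by rw [← hcd _ (by omega), ih]) (by rw [← hcd _ (by omega), ih]) with e | e | e
      · rw [e, ih]
      · have : φ (d j) = φ (c j) := by rw [ih]; exact e
        rw [φ.injective this, ih]
      · exact e.symm
    · rw [← hcd j hj, ih]

theorem Poly.rigid2 (h : Poly β m rk) {F : ℤ → β} (hF : IsFl m rk F) (φ ψ : β ≃o β)
    (hφ : ∀ j, φ (F j) = ψ (F j)) : φ = ψ := by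
  have : ψ⁻¹ * φ = 1 := h.rigid hF _ (by
    intro j
    change ψ.symm (φ (F j)) = F j
    rw [hφ]; simp)
  rw [inv_mul_eq_one] at this
  exact this.symm

theorem Poly.trans (h : Poly β m rk) {F : ℤ → β} (hF : IsFl m rk F) (ρ : ℤ → (β ≃o β))
    (hρ : ∀ i ∈ Finset.Icc 0 (m-1), (∀ j, j ≠ i → ρ i (F j) = F j) ∧ ρ i (F i) ≠ F i)
    (J : Finset ℤ) (hJ : J ⊆ Finset.Icc 0 (m-1)) (c : ℤ → β) (hc : IsFl m rk c)
    (hFc : ∀ i, i ∉ J → F i = c i) :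
    ∃ φ ∈ Subgroup.closure (ρ '' (J : Set ℤ)), ∀ j, φ (F j) = c j := by
  have hp := h.connected J hJ F c hF hc hFc
  clear hFc hc
  induction hp with
  | refl => exact ⟨1, one_mem _, fun _ => rfl⟩
  | tail _ hst ih =>
    rename_i c d _
    obtain ⟨φ, hφ, hφF⟩ := ih
    obtain ⟨hc, hd, i, hi, hcd⟩ := hst
    obtain ⟨r1, r2⟩ := hρ i (hJ hi)
    have hne : ∀ j, j ≠ i → φ.symm (d j) = F j := by
      intro j hj
      rw [← hcd j hj, ← hφF]; simp
    rcases h.dia hF (h.fl_map φ.symm hd) (h.fl_map (ρ i) hF) (hJ hi)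
      (hne _ (by omega)) (hne _ (by omega)) (r1 _ (by omega)) (r1 _ (by omega)) with e | e | e
    · refine ⟨φ, hφ, fun j => ?_⟩
      by_cases hj : j = i
      · subst hj; rw [← e]; simp
      · rw [← hne j hj]; simp
    · exact absurd e r2
    · refine ⟨φ * ρ i, mul_mem hφ (Subgroup.subset_closure ⟨i, hi, rfl⟩), fun j => ?_⟩
      change φ (ρ i (F j)) = d j
      by_cases hj : j = i
      · subst hj; rw [← e]; simp
      · rw [r1 j hj, ← hne j hj]; simp

theorem fix_of_mem {F : ℤ → β} (ρ : ℤ → (β ≃o β)) (J : Set ℤ)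
    (hρ : ∀ i ∈ J, (∀ j, j ≠ i → ρ i (F j) = F j)) (φ : β ≃o β)
    (hφ : φ ∈ Subgroup.closure (ρ '' J)) (j : ℤ) (hj : j ∉ J) : φ (F j) = F j := by
  induction hφ using Subgroup.closure_induction with
  | mem x hx =>
    obtain ⟨i, hi, rfl⟩ := hx
    exact hρ i hi j (by rintro rfl; exact hj hi)
  | one => rfl
  | mul x y _ _ h1 h2 => change x (y (F j)) = F j; rw [h2, h1]
  | inv x _ h1 => change x.symm (F j) = F j; rw [OrderIso.symm_apply_eq, h1]

theorem Poly.scgroup (h : Poly β m rk) {F : ℤ → β} (hF : IsFl m rk F) (ρ : ℤ → (β ≃o β))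
    (hρ : ∀ i ∈ Finset.Icc 0 (m-1), (∀ j, j ≠ i → ρ i (F j) = F j) ∧ ρ i (F i) ≠ F i) :
    Subgroup.closure (ρ '' Set.Icc (0 : ℤ) (m-1)) = ⊤ ∧
    (∀ i ∈ Set.Icc (0 : ℤ) (m-1), ρ i * ρ i = 1 ∧ ρ i ≠ 1) ∧
    (∀ i j : ℤ, 0 ≤ i → i < j - 1 → j ≤ m-1 → (ρ i * ρ j) ^ 2 = 1) ∧
    (∀ I J : Set ℤ, I ⊆ Set.Icc (0 : ℤ) (m-1) →
      J ⊆ Set.Icc (0 : ℤ) (m-1) →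
      Subgroup.closure (ρ '' I) ⊓ Subgroup.closure (ρ '' J) =
        Subgroup.closure (ρ '' (I ∩ J))) := by
  have hinv : ∀ i ∈ Set.Icc (0 : ℤ) (m-1), ρ i * ρ i = 1 ∧ ρ i ≠ 1 := by
    intro i hi
    have hi' : i ∈ Finset.Icc 0 (m-1) := by simpa using hi
    obtain ⟨r1, r2⟩ := hρ i hi'
    refine ⟨h.rigid hF _ fun j => ?_, fun he => r2 (by rw [he]; rfl)⟩
    change ρ i (ρ i (F j)) = F j
    by_cases hj : j = i
    · subst hj
      rcases h.dia (h.fl_map (ρ j) hF) hF (h.fl_map (ρ j) (h.fl_map (ρ j) hF)) hi'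
        (r1 _ (by omega)).symm (r1 _ (by omega)).symm
        (by simp only [r1 (j-1) (by omega)]) (by simp only [r1 (j+1) (by omega)]) with e | e | e
      · exact absurd e.symm r2
      · exact absurd ((ρ j).injective e) r2
      · exact e.symm
    · rw [r1 j hj, r1 j hj]
  have hcl : ∀ J : Set ℤ, J ⊆ Set.Icc (0 : ℤ) (m-1) → ∀ φ : β ≃o β,
      (∀ j, j ∉ J → φ (F j) = F j) → φ ∈ Subgroup.closure (ρ '' J) := by
    intro J hJ φ hφ
    have hfin : J.Finite := (Set.finite_Icc _ _).subset hJ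
    obtain ⟨ψ, hψ, hψF⟩ := h.trans hF ρ hρ hfin.toFinset
      (by intro i hi; simpa using hJ (by simpa using hi)) _ (h.fl_map φ hF)
      (by intro i hi; exact (hφ i (by simpa using hi)).symm)
    rw [h.rigid2 hF φ ψ (fun j => (hψF j).symm)]
    simpa using hψ
  refine ⟨?_, hinv, ?_, ?_⟩
  · rw [eq_top_iff]
    intro φ _
    refine hcl _ subset_rfl φ fun j hj => ?_
    exact h.fl_out (h.fl_map φ hF) hF (by simpa using hj)
  · intro i j hi hij hj
    have hiI : i ∈ Finset.Icc 0 (m-1) := by rw [Finset.mem_Icc]; omega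
    have hjI : j ∈ Finset.Icc 0 (m-1) := by rw [Finset.mem_Icc]; omega
    have key : ∀ i j : ℤ, i ∈ Finset.Icc 0 (m-1) → j ∈ Finset.Icc 0 (m-1) →
        i - 1 ≠ j → i + 1 ≠ j → i ≠ j → ρ j (ρ i (F i)) = ρ i (F i) := by
      intro i j hi hj h1 h2 h3
      obtain ⟨r1, r2⟩ := hρ i hi
      obtain ⟨s1, s2⟩ := hρ j hj
      rcases h.dia hF (h.fl_map (ρ i) hF) (h.fl_map (ρ j) (h.fl_map (ρ i) hF)) hi
        (r1 _ (by omega)) (r1 _ (by omega))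
        (by simp only [r1 (i-1) (by omega), s1 (i-1) h1])
        (by simp only [r1 (i+1) (by omega), s1 (i+1) h2]) with e | e | e
      · exact absurd e r2
      · nth_rewrite 2 [← s1 i h3] at e
        exact absurd ((ρ j).injective e) r2
      · exact e.symm
    have hcomm : ρ i * ρ j = ρ j * ρ i := by
      apply h.rigid2 hF
      intro k
      change ρ i (ρ j (F k)) = ρ j (ρ i (F k))
      by_cases hki : k = i
      · subst hki
        rw [(hρ j hjI).1 k (by omega), key k j hiI hjI (by omega) (by omega) (by omega)]
      by_cases hkj : k = j
      · subst hkj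
        rw [(hρ i hiI).1 k (by omega), key k i hjI hiI (by omega) (by omega) (by omega)]
      rw [(hρ j hjI).1 k hkj, (hρ i hiI).1 k hki, (hρ j hjI).1 k hkj]
    have c : Commute (ρ i) (ρ j) := hcomm
    rw [c.mul_pow, pow_two, pow_two, (hinv i (by simpa using hiI)).1,
      (hinv j (by simpa using hjI)).1, one_mul]
  · intro I J hI hJ
    apply le_antisymm
    · rintro φ ⟨h1, h2⟩
      refine hcl _ (inter_subset_left.trans hI) φ fun j hj => ?_
      by_cases hjI : j ∈ I
      · exact fix_of_mem ρ J (fun i hi => (hρ i (by simpa using hJ hi)).1) φ h2 j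
          (fun hjJ => hj ⟨hjI, hjJ⟩)
      · exact fix_of_mem ρ I (fun i hi => (hρ i (by simpa using hI hi)).1) φ h1 j hjI
    · exact le_inf (Subgroup.closure_mono (image_mono inter_subset_left))
        (Subgroup.closure_mono (image_mono inter_subset_right))
end

section
variable {α : Type*} [PartialOrder α] [BoundedOrder α] {n : ℤ} {rk : α → ℤ}

theorem pre_of_inc (hn : 1 ≤ n) (hK : IncComplex α n rk) : Pre α n rk where
  hm := by omega
  rbot := hK.rk_bot
  rtop := hK.rk_top
  smono := hK.rk_strictMono
  ext := by
    intro s hs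
    obtain ⟨Φ, hsΦ, hΦ, -⟩ := hK.chain_flag s hs
    have hch := hΦ.2.1
    have hcl : ∀ i : ℤ, max (-1) (min i n) ∈ Set.Icc (-1 : ℤ) n := by
      intro i; rw [Set.mem_Icc]; omega
    choose c hcΦ hcr using fun i : ℤ => hK.flag_rk Φ hΦ _ (hcl i)
    have inj : ∀ x ∈ Φ, ∀ y ∈ Φ, rk x = rk y → x = y := by
      intro x hx y hy hr
      by_contra hne
      rcases hch hx hy hne with h | h
      · have := hK.rk_strictMono _ _ (lt_of_le_of_ne h hne); omega
      · have := hK.rk_strictMono _ _ (lt_of_le_of_ne h (Ne.symm hne)); omega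
    refine ⟨c, ⟨?_, hcr⟩, ?_⟩
    · intro i j hij
      by_cases he : c i = c j
      · exact he.le
      rcases hch (hcΦ i) (hcΦ j) he with h | h
      · exact h
      · have h1 := hK.rk_strictMono _ _ (lt_of_le_of_ne h (Ne.symm he))
        rw [hcr, hcr] at h1
        omega
    · intro x hx
      refine ⟨rk x, inj _ (hcΦ _) _ (hsΦ hx) ?_⟩
      rw [hcr]
      have h1 : -1 ≤ rk x := by
        rcases eq_or_lt_of_le (bot_le (a := x)) with h | h
        · rw [← h, hK.rk_bot]
        · have := hK.rk_strictMono _ _ h; rw [hK.rk_bot] at this; omega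
      have h2 : rk x ≤ n := by
        rcases eq_or_lt_of_le (le_top (a := x)) with h | h
        · rw [h, hK.rk_top]
        · have := hK.rk_strictMono _ _ h; rw [hK.rk_top] at this; omega
      omega

theorem flag_of_fl (h : Pre α n rk) {c : ℤ → α} (hc : IsFl n rk c) :
    IsFlagOf Set.univ (range c) := by
  refine ⟨subset_univ _, ?_, ?_⟩
  · rintro _ ⟨i, rfl⟩ _ ⟨j, rfl⟩ _
    rcases le_total i j with hij | hij
    · left; exact hc.1 hij
    · right; exact hc.1 hij
  · intro Ψ _ hΨ hs
    refine subset_antisymm ?_ hs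
    intro x hx
    have hr : rk (c (rk x)) = rk x := by
      rw [hc.2]; have := h.lb x; have := h.ub x; omega
    refine ⟨rk x, ?_⟩
    by_contra hne
    rcases hΨ (hs ⟨rk x, rfl⟩) hx hne with h1 | h1
    · exact hne (h.eq_of_le h1 hr)
    · exact hne (h.eq_of_le h1 hr.symm).symm

theorem fl_update (h : Pre α n rk) {c : ℤ → α} (hc : IsFl n rk c) {i : ℤ} {H : α}
    (hi : i ∈ Set.Icc 0 (n-1)) (h1 : c (i-1) < H) (h2 : H < c (i+1)) :
    IsFl n rk (Function.update c i H) := by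
  have r1 := h.smono _ _ h1
  have r2 := h.smono _ _ h2
  rw [hc.2] at r1 r2
  rw [Set.mem_Icc] at hi
  constructor
  · intro j k hjk
    by_cases hj : j = i <;> by_cases hk : k = i
    · subst hj; subst hk; exact le_rfl
    · subst hj
      rw [Function.update_self, Function.update_of_ne hk]
      exact h2.le.trans (hc.1 (by omega))
    · subst hk
      rw [Function.update_self, Function.update_of_ne hj]
      exact (hc.1 (by omega)).trans h1.le
    · rw [Function.update_of_ne hj, Function.update_of_ne hk]
      exact hc.1 hjk
  · intro j
    by_cases hj : j = i
    · subst hj; rw [Function.update_self]; omega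
    · rw [Function.update_of_ne hj]; exact hc.2 j

theorem poly_of_inc (hn : 1 ≤ n) (hK : IncComplex α n rk)
    (hpoly : ∀ A B : α, A < B → rk B = rk A + 2 → rk B ≤ n - 1 →
      {H : α | A < H ∧ H < B}.ncard = 2) (T : α) (hT : rk T = n - 1) :
    Poly (Set.Iic T) (n-1) (fun x => rk x.1) where
  hm := by omega
  rbot := hK.rk_bot
  rtop := hT
  smono := fun a b hab => hK.rk_strictMono _ _ hab
  ext := by
    intro s hs
    have hp := pre_of_inc hn hK
    have hch : IsChain (· ≤ ·) (insert T (Subtype.val '' s)) := by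
      refine IsChain.insert ?_ ?_
      · rintro _ ⟨x, hx, rfl⟩ _ ⟨y, hy, rfl⟩ hne
        exact hs hx hy (fun h => hne (by rw [h]))
      · rintro _ ⟨x, hx, rfl⟩ _
        right; exact x.2
    obtain ⟨c, hc, hsc⟩ := hp.ext _ hch
    have hcT : c (n-1) = T := by
      rw [← hT]; exact hp.fl_rk hc (hsc (by simp))
    refine ⟨fun i => ⟨c (min i (n-1)), by
      have := hc.1 (min_le_right i (n-1)); rw [hcT] at this; exact this⟩, ⟨?_, ?_⟩, ?_⟩
    · intro i j hij
      exact hc.1 (min_le_min_right _ hij)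
    · intro i
      simp only
      rw [hc.2]; omega
    · intro x hx
      refine ⟨rk x.1, Subtype.ext ?_⟩
      simp only
      have : rk x.1 ≤ n - 1 := hT ▸ hp.mono x.2
      rw [min_eq_left this]
      exact hp.fl_rk hc (hsc (by right; exact ⟨x, hx, rfl⟩))
  conn := by
    intro A B hAB hr H K h1 h2 h3 h4
    have hc := hK.strong_conn A.1 B.1 hAB hr H.1 K.1 h1 h2 h3 h4
    obtain ⟨K, hKT⟩ := K
    simp only at hc
    clear h3 h4
    induction hc with
    | refl => exact Relation.ReflTransGen.refl
    | tail _ hst ih =>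
      obtain ⟨a1, a2, b1, b2, hab⟩ := hst
      exact (ih (a2.le.trans B.2)).tail ⟨a1, a2, b1, b2, hab⟩
  diam := by
    intro A B hAB hr
    have hB : rk B.1 ≤ n - 1 := hT ▸ (pre_of_inc hn hK).mono B.2
    rw [← hpoly A.1 B.1 hAB hr hB, ← Set.ncard_image_of_injective _ Subtype.val_injective]
    congr 1
    ext x
    constructor
    · rintro ⟨y, hy, rfl⟩; exact hy
    · rintro hx; exact ⟨⟨x, hx.2.le.trans B.2⟩, hx, rfl⟩

def restr (T : α) (g : α ≃o α) (hg : g T = T) : Set.Iic T ≃o Set.Iic T where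
  toFun x := ⟨g x.1, by
    have h := g.monotone x.2
    rwa [hg] at h⟩
  invFun x := ⟨g.symm x.1, by
    have h := g.symm.monotone x.2
    rwa [(OrderIso.symm_apply_eq g).2 hg.symm] at h⟩
  left_inv x := by simp
  right_inv x := by simp
  map_rel_iff' := by
    intro a b
    exact g.le_iff_le

def restrHom (T : α) (G : Subgroup (α ≃o α)) (hG : ∀ g ∈ G, g T = T) :
    G →* (Set.Iic T ≃o Set.Iic T) :=
  MonoidHom.mk' (fun g => restr T g.1 (hG g.1 g.2)) (fun _ _ => rfl)

end

end PCFA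

/-- for a regular polytope complex of rank `n` (all facets are
abstract polytopes), `R_{-1}` is a normal subgroup of the facet stabilizer
`Γ_{n-1} = ⟨R_{-1},R_0,…,R_{n-2}⟩`, equals the kernel of its action on the base
facet `F_{n-1}/F_{-1}`, and `Γ_{n-1}/R_{-1}` is isomorphic to the automorphism
group of the base facet, which is a string C-group (of rank `n-1`). -/
theorem polytope_complex_facet_action
    {α : Type*} [PartialOrder α] [BoundedOrder α] (n : ℤ) (rk : α → ℤ)
    (hn : 1 ≤ n) (hK : IncComplex α n rk)
    (Γ : Subgroup (α ≃o α)) (hΓ : FlagTrans Γ)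
    (F : ℤ → α) (hFflag : IsFlagOf Set.univ (F '' Set.Icc (-1 : ℤ) n))
    (hFrk : ∀ i ∈ Set.Icc (-1 : ℤ) n, rk (F i) = i)
    (hpoly : ∀ A B : α, A < B → rk B = rk A + 2 → rk B ≤ n - 1 →
      {H : α | A < H ∧ H < B}.ncard = 2) :
    FlagStab Γ F n ⊆ ↑(FacetStab Γ F n) ∧
    (∀ g ∈ FacetStab Γ F n, ∀ h ∈ FlagStab Γ F n,
      g * h * g⁻¹ ∈ FlagStab Γ F n) ∧
    FlagStab Γ F n =
      {g : α ≃o α | g ∈ FacetStab Γ F n ∧ ∀ x : α, x ≤ F (n - 1) → g x = x} ∧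
    ∃ f : ↥(FacetStab Γ F n) →*
        (↥(Set.Iic (F (n - 1))) ≃o ↥(Set.Iic (F (n - 1)))),
      Function.Surjective f ∧
      (∀ g : ↥(FacetStab Γ F n), f g = 1 ↔ (g : α ≃o α) ∈ FlagStab Γ F n) ∧
      ∃ ρ : ℤ → (↥(Set.Iic (F (n - 1))) ≃o ↥(Set.Iic (F (n - 1)))),
        Subgroup.closure (ρ '' Set.Icc (0 : ℤ) (n - 2)) = ⊤ ∧
        (∀ i ∈ Set.Icc (0 : ℤ) (n - 2), ρ i * ρ i = 1 ∧ ρ i ≠ 1) ∧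
        (∀ i j : ℤ, 0 ≤ i → i < j - 1 → j ≤ n - 2 → (ρ i * ρ j) ^ 2 = 1) ∧
        (∀ I J : Set ℤ, I ⊆ Set.Icc (0 : ℤ) (n - 2) →
          J ⊆ Set.Icc (0 : ℤ) (n - 2) →
          Subgroup.closure (ρ '' I) ⊓ Subgroup.closure (ρ '' J) =
            Subgroup.closure (ρ '' (I ∩ J))) := by
  have hp := PCFA.pre_of_inc hn hK
  have hT : rk (F (n-1)) = n - 1 := hFrk _ (by rw [Set.mem_Icc]; omega)
  have hP := PCFA.poly_of_inc hn hK hpoly (F (n-1)) hT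
  have hmono : ∀ i ∈ Set.Icc (-1 : ℤ) n, ∀ j ∈ Set.Icc (-1 : ℤ) n, i ≤ j → F i ≤ F j := by
    intro i hi j hj hij
    by_cases he : F i = F j
    · exact he.le
    rcases hFflag.2.1 ⟨i, hi, rfl⟩ ⟨j, hj, rfl⟩ he with h | h
    · exact h
    · have h1 := hK.rk_strictMono _ _ (lt_of_le_of_ne h (Ne.symm he))
      rw [hFrk i hi, hFrk j hj] at h1
      omega
  let Fa : ℤ → α := fun i => F (max (-1) (min i n))
  have hFa : PCFA.IsFl n rk Fa := by
    constructor
    · intro i j hij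
      apply hmono
      · rw [Set.mem_Icc]; omega
      · rw [Set.mem_Icc]; omega
      · omega
    · intro i
      apply hFrk; rw [Set.mem_Icc]; omega
  have hFaF : ∀ i ∈ Set.Icc (-1 : ℤ) n, Fa i = F i := by
    intro i hi
    rw [Set.mem_Icc] at hi
    simp only [Fa]
    congr 1; omega
  have hFaR : range Fa = F '' Set.Icc (-1 : ℤ) n := by
    ext x; constructor
    · rintro ⟨i, rfl⟩
      exact ⟨_, by rw [Set.mem_Icc]; omega, rfl⟩
    · rintro ⟨i, hi, rfl⟩
      exact ⟨i, hFaF i hi⟩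
  let Fp : ℤ → Set.Iic (F (n-1)) := fun i => ⟨F (max (-1) (min i (n-1))), by
    apply hmono
    · rw [Set.mem_Icc]; omega
    · rw [Set.mem_Icc]; omega
    · omega⟩
  have hFp : PCFA.IsFl (n-1) (fun x : Set.Iic (F (n-1)) => rk x.1) Fp := by
    constructor
    · intro i j hij
      apply hmono
      · rw [Set.mem_Icc]; omega
      · rw [Set.mem_Icc]; omega
      · omega
    · intro i
      apply hFrk; rw [Set.mem_Icc]; omega
  have hFtop : F n = ⊤ := hp.eq_of_le le_top (by
    rw [hp.rtop]; exact hFrk n (by rw [Set.mem_Icc]; omega))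
  have hRmem : ∀ i ∈ Set.Icc (-1 : ℤ) (n-2), ∀ g ∈ Rset Γ F n i, g ∈ FacetStab Γ F n := by
    intro i hi g hg
    exact Subgroup.subset_closure (Set.mem_biUnion hi hg)
  have hsub : ∀ g ∈ FlagStab Γ F n, g ∈ FacetStab Γ F n := by
    intro g hg
    exact hRmem (-1) (by rw [Set.mem_Icc]; omega) g ⟨hg.1, fun j hj _ => hg.2 j hj⟩
  have hfs : ∀ g ∈ FacetStab Γ F n, g ∈ Γ ∧ g (F (n-1)) = F (n-1) := by
    intro g hg
    induction hg using Subgroup.closure_induction with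
    | mem x hx =>
      simp only [Set.mem_iUnion] at hx
      obtain ⟨i, hi, hx⟩ := hx
      rw [Set.mem_Icc] at hi
      exact ⟨hx.1, hx.2 _ (by rw [Set.mem_Icc]; omega) (by omega)⟩
    | one => exact ⟨one_mem _, rfl⟩
    | mul x y _ _ h1 h2 =>
      refine ⟨mul_mem h1.1 h2.1, ?_⟩
      change x (y _) = _
      rw [h2.2, h1.2]
    | inv x _ h1 =>
      refine ⟨inv_mem h1.1, ?_⟩
      change x.symm _ = _
      rw [OrderIso.symm_apply_eq, h1.2]
  let f := PCFA.restrHom (F (n-1)) (FacetStab Γ F n) (fun g hg => (hfs g hg).2)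
  have hfv : ∀ (g : FacetStab Γ F n) x, (f g x).1 = g.1 x.1 := fun g x => rfl
  have hker : ∀ g : FacetStab Γ F n, f g = 1 ↔ (g : α ≃o α) ∈ FlagStab Γ F n := by
    intro g
    constructor
    · intro hg
      refine ⟨(hfs _ g.2).1, fun j hj => ?_⟩
      by_cases hjn : j = n
      · rw [hjn, hFtop]; exact map_top g.1
      · rw [Set.mem_Icc] at hj
        have hle : F j ≤ F (n-1) := by
          apply hmono
          · rw [Set.mem_Icc]; omega
          · rw [Set.mem_Icc]; omega
          · omega
        have := hfv g ⟨F j, hle⟩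
        rw [hg] at this
        exact this.symm
    · intro hg
      apply hP.rigid hFp
      intro j
      apply Subtype.ext
      rw [hfv]
      apply hg.2
      rw [Set.mem_Icc]; omega
  have hr : ∀ i : ℤ, ∃ r : FacetStab Γ F n, i ∈ Finset.Icc 0 (n-1-1) →
      (∀ j, j ≠ i → f r (Fp j) = Fp j) ∧ f r (Fp i) ≠ Fp i := by
    intro i
    by_cases hi : i ∈ Finset.Icc 0 (n-1-1)
    swap
    · exact ⟨1, fun h => absurd h hi⟩
    rw [Finset.mem_Icc] at hi
    have hlt := hp.fl_lt hFa (show -1 ≤ i-1 by omega) (show i-1 < i+1 by omega) (by omega)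
    obtain ⟨H, H', hne, a1, a2, b1, b2⟩ := hK.two_between _ _ hlt (by
      rw [hFa.2, hFa.2]; omega)
    obtain ⟨L, hL, l1, l2⟩ : ∃ L, L ≠ F i ∧ Fa (i-1) < L ∧ L < Fa (i+1) := by
      by_cases h : H = F i
      · exact ⟨H', fun h' => hne (by rw [h, h']), b1, b2⟩
      · exact ⟨H, h, a1, a2⟩
    have hc := PCFA.fl_update hp hFa (by rw [Set.mem_Icc]; omega) l1 l2
    obtain ⟨r, hrΓ, hrim⟩ := hΓ _ _ (PCFA.flag_of_fl hp hFa) (PCFA.flag_of_fl hp hc)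
    have hrF : ∀ j, r (Fa j) = Function.update Fa i L j := by
      intro j
      refine (hp.fl_of_mem hc ?_ ?_).symm
      · rw [← hrim]; exact ⟨_, ⟨j, rfl⟩, rfl⟩
      · rw [hp.rank_eq]; exact hFa.2 j
    have hrR : r ∈ Rset Γ F n i := by
      refine ⟨hrΓ, fun j hj hji => ?_⟩
      have := hrF j
      rwa [Function.update_of_ne hji, hFaF j hj] at this
    refine ⟨⟨r, hRmem i (by rw [Set.mem_Icc]; omega) r hrR⟩, fun _ => ⟨?_, ?_⟩⟩
    · intro j hj
      apply Subtype.ext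
      rw [hfv]
      apply hrR.2
      · rw [Set.mem_Icc]; omega
      · omega
    · intro he
      have h1 := congrArg Subtype.val he
      rw [hfv] at h1
      have h2 : (Fp i).1 = F i := by
        change F _ = F i
        congr 1; omega
      rw [h2] at h1
      have h3 := hrF i
      rw [Function.update_self, hFaF i (by rw [Set.mem_Icc]; omega)] at h3
      exact hL (h3.symm.trans h1)
  choose r hr using hr
  have hsc := hP.scgroup hFp (fun i => f (r i)) hr
  rw [show n - 1 - 1 = n - 2 by ring] at hsc
  have hsurj : Function.Surjective f := by
    rw [← MonoidHom.range_eq_top, eq_top_iff, ← hsc.1, Subgroup.closure_le]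
    rintro _ ⟨i, _, rfl⟩
    exact ⟨r i, rfl⟩
  refine ⟨hsub, ?_, ?_, f, hsurj, hker, _, hsc⟩
  · intro g hg h hh
    have h1 := (hker ⟨h, hsub h hh⟩).2 hh
    refine (hker (⟨g, hg⟩ * ⟨h, hsub h hh⟩ * ⟨g, hg⟩⁻¹)).1 ?_
    rw [map_mul, map_mul, h1, mul_one, ← map_mul, mul_inv_cancel, map_one]
  · ext g
    constructor
    · intro hg
      refine ⟨hsub g hg, fun x hx => ?_⟩
      have h1 := (hker ⟨g, hsub g hg⟩).2 hg
      have := hfv ⟨g, hsub g hg⟩ ⟨x, hx⟩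
      rw [h1] at this
      exact this.symm
    · rintro ⟨hg, hfix⟩
      refine (hker ⟨g, hg⟩).1 ?_
      ext x
      exact hfix x.1 x.2
end

section
/- Let L be an abstract regular m-polytope with automorphism group Γ = ⟨ρ_0, ..., ρ_{m-1}⟩, and let 1 ≤ n ≤ m. Then the (n-1)-skeleton skel_{n-1}(L) (faces of L of rank at most n-1 together with a greatest face of rank n) is a regular polytope complex of rank n on which Γ acts flag-transitively, with distinguished generating subgroups R_{-1} = R_n = ⟨ρ_n,...,ρ_{m-1}⟩, R_i = ⟨ρ_i, ρ_n, ..., ρ_{m-1}⟩ for i ≤ n-2, and R_{n-1} = ⟨ρ_{n-1}, ρ_n, ..., ρ_{m-1}⟩. -/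
open Set Pointwise

/-- The bounded order on the `(n-1)`-skeleton of an `m`-polytope: faces of rank
at most `n-1` together with the greatest face (of rank `m`, reassigned rank `n`). -/
def SkelBO {α : Type*} [PartialOrder α] [BoundedOrder α] (rk : α → ℤ)
    (n m : ℤ) (hbot : rk (⊥ : α) = -1) (htop : rk (⊤ : α) = m)
    (hn : 1 ≤ n) : BoundedOrder {x : α // rk x ≤ n - 1 ∨ rk x = m} where
  bot := ⟨⊥, Or.inl (by rw [hbot]; omega)⟩
  bot_le x := bot_le (a := x.1)
  top := ⟨⊤, Or.inr htop⟩
  le_top x := le_top (a := x.1)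

structure Ctx {α : Type*} [PartialOrder α] [BoundedOrder α] (m : ℤ) (rk : α → ℤ)
    (F : ℤ → α) (ρ : ℤ → (α ≃o α)) : Prop where
  hm : 1 ≤ m
  hK : IncComplex α m rk
  hdiamond : ∀ A B : α, A < B → rk B = rk A + 2 → {H : α | A < H ∧ H < B}.ncard = 2
  hreg : IsRegularIC α
  hFflag : IsFlagOf Set.univ (F '' Set.Icc (-1 : ℤ) m)
  hFrk : ∀ i ∈ Set.Icc (-1 : ℤ) m, rk (F i) = i
  hρ : ∀ i ∈ Set.Icc (0 : ℤ) (m - 1), ρ i (F i) ≠ F i ∧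
      ∀ j ∈ Set.Icc (-1 : ℤ) m, j ≠ i → ρ i (F j) = F j
  hgen : Subgroup.closure (ρ '' Set.Icc (0 : ℤ) (m - 1)) = (⊤ : Subgroup (α ≃o α))

namespace Ctx

variable {α : Type*} [PartialOrder α] [BoundedOrder α] {m : ℤ} {rk : α → ℤ}
    {F : ℤ → α} {ρ : ℤ → (α ≃o α)}

theorem rk_le (C : Ctx m rk F ρ) (x : α) : rk x ≤ m := by
  rcases eq_or_lt_of_le (le_top (a := x)) with h | h
  · rw [h, C.hK.rk_top]
  · have := C.hK.rk_strictMono _ _ h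
    rw [C.hK.rk_top] at this; omega

theorem le_rk (C : Ctx m rk F ρ) (x : α) : -1 ≤ rk x := by
  rcases eq_or_lt_of_le (bot_le (a := x)) with h | h
  · rw [← h, C.hK.rk_bot]
  · have := C.hK.rk_strictMono _ _ h
    rw [C.hK.rk_bot] at this; omega

theorem rk_mem (C : Ctx m rk F ρ) (x : α) : rk x ∈ Set.Icc (-1 : ℤ) m := ⟨C.le_rk x, C.rk_le x⟩

theorem rk_mono (C : Ctx m rk F ρ) {x y : α} (h : x ≤ y) : rk x ≤ rk y := by
  rcases eq_or_lt_of_le h with h | h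
  · rw [h]
  · exact (C.hK.rk_strictMono _ _ h).le

theorem eq_of_le (C : Ctx m rk F ρ) {x y : α} (h : x ≤ y) (h' : rk x = rk y) : x = y := by
  rcases eq_or_lt_of_le h with h | h
  · exact h
  · have := C.hK.rk_strictMono _ _ h; omega

theorem eq_top (C : Ctx m rk F ρ) {x : α} (h : rk x = m) : x = ⊤ :=
  C.eq_of_le le_top (by rw [h, C.hK.rk_top])

theorem lt_of_comp (C : Ctx m rk F ρ) {x y : α} (h : x ≤ y ∨ y ≤ x) (h' : rk x < rk y) :
    x < y := by
  rcases h with h | h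
  · exact lt_of_le_of_ne h (fun e => by rw [e] at h'; omega)
  · have := C.rk_mono h; omega

theorem eq_of_comp (C : Ctx m rk F ρ) {x y : α} (h : x ≤ y ∨ y ≤ x) (h' : rk x = rk y) :
    x = y := by
  rcases h with h | h
  · exact C.eq_of_le h h'
  · exact (C.eq_of_le h h'.symm).symm

theorem F_lt (C : Ctx m rk F ρ) {i j : ℤ} (hi : i ∈ Set.Icc (-1 : ℤ) m)
    (hj : j ∈ Set.Icc (-1 : ℤ) m) (h : i < j) : F i < F j := by
  have := C.hFflag.2.1.total (mem_image_of_mem F hi) (mem_image_of_mem F hj)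
  exact C.lt_of_comp this (by rw [C.hFrk i hi, C.hFrk j hj]; exact h)

theorem F_le (C : Ctx m rk F ρ) {i j : ℤ} (hi : i ∈ Set.Icc (-1 : ℤ) m)
    (hj : j ∈ Set.Icc (-1 : ℤ) m) (h : i ≤ j) : F i ≤ F j := by
  rcases eq_or_lt_of_le h with h | h
  · rw [h]
  · exact (C.F_lt hi hj h).le

theorem F_comp (C : Ctx m rk F ρ) {i j : ℤ} (hi : i ∈ Set.Icc (-1 : ℤ) m)
    (hj : j ∈ Set.Icc (-1 : ℤ) m) : F i ≤ F j ∨ F j ≤ F i := by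
  rcases le_total i j with h | h
  · exact Or.inl (C.F_le hi hj h)
  · exact Or.inr (C.F_le hj hi h)

theorem exists_flag (C : Ctx m rk F ρ) (c : Set α) (hc : IsChain (· ≤ ·) c) :
    ∃ Φ : Set α, c ⊆ Φ ∧ IsFlagOf Set.univ Φ :=
  let ⟨Φ, h, h', _⟩ := C.hK.chain_flag c hc
  ⟨Φ, h, h'⟩

theorem exists_rk (C : Ctx m rk F ρ) (x : α) (i : ℤ) (hi : i ∈ Set.Icc (-1 : ℤ) m) :
    ∃ y, rk y = i ∧ (x ≤ y ∨ y ≤ x) := by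
  obtain ⟨Φ, h, h'⟩ := C.exists_flag {x} (by simp)
  obtain ⟨y, hy, e⟩ := C.hK.flag_rk Φ h' i hi
  exact ⟨y, e, h'.2.1.total (h rfl) hy⟩

theorem rk_aut_le (C : Ctx m rk F ρ) (g : α ≃o α) :
    ∀ (k : ℕ) (x : α), rk x = (k : ℤ) - 1 → rk x ≤ rk (g x) := by
  intro k
  induction k with
  | zero => intro x hx; have := C.le_rk (g x); simp at hx; omega
  | succ k ih =>
    intro x hx
    have h1 := C.rk_le x
    push_cast at hx
    obtain ⟨y, hy, e⟩ := C.exists_rk x ((k : ℤ) - 1) ⟨by omega, by omega⟩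
    have hlt : y < x := C.lt_of_comp e.symm (by omega)
    have h2 := ih y hy
    have h3 := C.hK.rk_strictMono _ _ (g.lt_iff_lt.2 hlt)
    omega

theorem rk_aut (C : Ctx m rk F ρ) (g : α ≃o α) (x : α) : rk (g x) = rk x := by
  have key : ∀ (g : α ≃o α) x, rk x ≤ rk (g x) := fun g x =>
    C.rk_aut_le g (rk x + 1).toNat x (by have := C.le_rk x; omega)
  have h1 := key g x
  have h2 := key g.symm (g x)
  rw [OrderIso.symm_apply_apply] at h2
  omega

/-- every chain lies in a translate of the base flag -/
theorem ext (C : Ctx m rk F ρ) (c : Set α) (hc : IsChain (· ≤ ·) c) :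
    ∃ h : α ≃o α, ∀ x ∈ c, h (F (rk x)) = x := by
  obtain ⟨Φ, h, h'⟩ := C.exists_flag c hc
  obtain ⟨g, hg⟩ := C.hreg _ _ C.hFflag h'
  refine ⟨g, fun x hx => ?_⟩
  have := h hx
  rw [← hg] at this
  obtain ⟨_, ⟨i, hi, rfl⟩, rfl⟩ := this
  rw [C.rk_aut, C.hFrk i hi]

theorem diam (C : Ctx m rk F ρ) {i : ℤ} (hi : i ∈ Set.Icc (0 : ℤ) (m - 1)) {x y z : α}
    (hx : F (i-1) < x ∧ x < F (i+1)) (hy : F (i-1) < y ∧ y < F (i+1))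
    (hz : F (i-1) < z ∧ z < F (i+1)) (hxy : x ≠ y) (hxz : x ≠ z) : y = z := by
  have hi' := hi
  obtain ⟨h0, h1⟩ := hi'
  have h := C.hdiamond (F (i-1)) (F (i+1)) (hx.1.trans hx.2)
    (by rw [C.hFrk _ ⟨by omega, by omega⟩, C.hFrk _ ⟨by omega, by omega⟩]; ring)
  obtain ⟨p, q, -, e⟩ := Set.ncard_eq_two.1 h
  have hx' : x ∈ ({p, q} : Set α) := e ▸ hx
  have hy' : y ∈ ({p, q} : Set α) := e ▸ hy
  have hz' : z ∈ ({p, q} : Set α) := e ▸ hz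
  simp only [Set.mem_insert_iff, Set.mem_singleton_iff] at hx' hy' hz'
  grind

/-- image of `F i` under an automorphism fixing its neighbours -/
theorem between (C : Ctx m rk F ρ) {i : ℤ} (hi : i ∈ Set.Icc (0 : ℤ) (m - 1)) (g : α ≃o α)
    (h1 : g (F (i-1)) = F (i-1)) (h2 : g (F (i+1)) = F (i+1)) :
    F (i-1) < g (F i) ∧ g (F i) < F (i+1) := by
  obtain ⟨h0, h1'⟩ := hi
  constructor
  · conv_lhs => rw [← h1]
    exact g.lt_iff_lt.2 (C.F_lt ⟨by omega, by omega⟩ ⟨by omega, by omega⟩ (by omega))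
  · conv_rhs => rw [← h2]
    exact g.lt_iff_lt.2 (C.F_lt ⟨by omega, by omega⟩ ⟨by omega, by omega⟩ (by omega))

theorem fix_inv {g : α ≃o α} {x : α} (h : g x = x) : g⁻¹ x = x := by
  conv_lhs => rw [← h]
  exact g.symm_apply_apply x

theorem conj_aux (C : Ctx m rk F ρ) {i : ℤ} (hi : i ∈ Set.Icc (0 : ℤ) (m - 1)) (r : α ≃o α)
    (hr : r (F i) ≠ F i) (hr' : ∀ j ∈ Set.Icc (-1 : ℤ) m, j ≠ i → r (F j) = F j)
    (g : α ≃o α) (hg : ∀ j ∈ Set.Icc (-1 : ℤ) m, g (F j) = F j) :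
    ∀ j ∈ Set.Icc (-1 : ℤ) m, g (r (F j)) = r (F j) := by
  intro j hj
  by_cases hji : j = i
  · subst hji
    have h0 := hi.1
    have h1 := hi.2
    have m1 : j - 1 ∈ Set.Icc (-1 : ℤ) m := ⟨by omega, by omega⟩
    have m2 : j + 1 ∈ Set.Icc (-1 : ℤ) m := ⟨by omega, by omega⟩
    have a1 := hr' _ m1 (by omega)
    have a2 := hr' _ m2 (by omega)
    have b := C.between hi r a1 a2
    have b2 := C.between hi (g * r) (by rw [RelIso.mul_apply, a1, hg _ m1])
      (by rw [RelIso.mul_apply, a2, hg _ m2])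
    rw [RelIso.mul_apply] at b2
    have b3 := C.between hi g (hg _ m1) (hg _ m2)
    rw [hg _ hj] at b3
    refine C.diam hi b3 b2 b (fun e => hr ?_) hr.symm
    apply g.injective
    rw [← e, hg _ hj]
  · rw [hr' j hj hji, hg j hj]

theorem rigid (C : Ctx m rk F ρ) (g : α ≃o α) (hg : ∀ j ∈ Set.Icc (-1 : ℤ) m, g (F j) = F j) :
    g = 1 := by
  have key : ∀ h : α ≃o α, ∀ g : α ≃o α, (∀ j ∈ Set.Icc (-1 : ℤ) m, g (F j) = F j) →
      (∀ j ∈ Set.Icc (-1 : ℤ) m, g (h (F j)) = h (F j)) ∧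
      (∀ j ∈ Set.Icc (-1 : ℤ) m, g (h⁻¹ (F j)) = h⁻¹ (F j)) := by
    intro h
    have hh : h ∈ Subgroup.closure (ρ '' Set.Icc (0 : ℤ) (m - 1)) := by rw [C.hgen]; trivial
    induction hh using Subgroup.closure_induction with
    | mem x hx =>
      obtain ⟨i, hi, rfl⟩ := hx
      intro g hg
      refine ⟨C.conj_aux hi _ (C.hρ i hi).1 (C.hρ i hi).2 g hg,
        C.conj_aux hi _ (fun e => (C.hρ i hi).1 ?_) (fun j hj hne => fix_inv ((C.hρ i hi).2 j hj hne))
          g hg⟩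
      have := fix_inv e
      rwa [inv_inv] at this
    | one => intro g hg; exact ⟨hg, by simpa using hg⟩
    | mul x y _ _ hx hy =>
      intro g hg
      constructor
      · have h1 := (hy (x⁻¹ * g * x) (fun j hj => by
          simp only [RelIso.mul_apply]
          rw [(hx g hg).1 j hj]; exact x.symm_apply_apply _)).1
        intro j hj
        have := congrArg x (h1 j hj)
        simp only [RelIso.mul_apply] at this ⊢
        exact (x.apply_symm_apply _).symm.trans this
      · have h1 := (hx (y * g * y⁻¹) (fun j hj => by
          simp only [RelIso.mul_apply]
          rw [(hy g hg).2 j hj]; exact y.apply_symm_apply _)).2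
        intro j hj
        have := congrArg (⇑(y⁻¹)) (h1 j hj)
        simp only [RelIso.mul_apply, mul_inv_rev] at this ⊢
        exact (y.symm_apply_apply _).symm.trans this
    | inv x _ hx => intro g hg; exact ⟨(hx g hg).2, by rw [inv_inv]; exact (hx g hg).1⟩
  ext x
  obtain ⟨h, hh⟩ := C.ext {x} (by simp)
  have := (key h g hg).1 (rk x) (C.rk_mem x)
  rw [hh x rfl] at this
  exact this

theorem closure_fix (C : Ctx m rk F ρ) (J : Set ℤ) (hJ : J ⊆ Set.Icc (0 : ℤ) (m - 1))
    (g : α ≃o α) (hg : g ∈ Subgroup.closure (ρ '' J)) :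
    ∀ j ∈ Set.Icc (-1 : ℤ) m, j ∉ J → g (F j) = F j := by
  intro j hj hjJ
  induction hg using Subgroup.closure_induction with
  | mem x hx =>
    obtain ⟨i, hi, rfl⟩ := hx
    exact (C.hρ i (hJ hi)).2 j hj (fun e => hjJ (e ▸ hi))
  | one => rfl
  | mul x y _ _ hx hy => rw [RelIso.mul_apply, hy, hx]
  | inv x _ hx => exact fix_inv hx

theorem stab (C : Ctx m rk F ρ) (J : Finset ℤ) :
    (J : Set ℤ) ⊆ Set.Icc (0 : ℤ) (m - 1) → ∀ g : α ≃o α,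
    (∀ j ∈ Set.Icc (-1 : ℤ) m, j ∉ J → g (F j) = F j) →
    g ∈ Subgroup.closure (ρ '' (J : Set ℤ)) := by
  induction J using Finset.strongInduction with
  | H J ih =>
  intro hJ g hg
  have mono : ∀ K ⊂ J, ∀ g : α ≃o α, (∀ j ∈ Set.Icc (-1 : ℤ) m, j ∉ K → g (F j) = F j) →
      g ∈ Subgroup.closure (ρ '' (J : Set ℤ)) := by
    intro K hK g hg
    have hs : (K : Set ℤ) ⊆ J := Finset.coe_subset.2 hK.1
    exact Subgroup.closure_mono (Set.image_mono hs) (ih K hK (hs.trans hJ) g hg)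
  rcases J.eq_empty_or_nonempty with rfl | hne
  · rw [C.rigid g (fun j hj => hg j hj (by simp))]
    exact one_mem _
  obtain ⟨a, haJ, ha⟩ : ∃ a ∈ J, ∀ x ∈ J, a ≤ x :=
    ⟨J.min' hne, J.min'_mem hne, fun x hx => J.min'_le x hx⟩
  obtain ⟨b, hbJ, hb⟩ : ∃ b ∈ J, ∀ x ∈ J, x ≤ b :=
    ⟨J.max' hne, J.max'_mem hne, fun x hx => J.le_max' x hx⟩
  have ha1 := hJ haJ
  have hb1 := hJ hbJ
  have hab := ha b hbJ
  by_cases hs : ∃ s, a < s ∧ s < b ∧ s ∉ J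
  · obtain ⟨s, has, hsb, hsJ⟩ := hs
    have hsm : s ∈ Set.Icc (-1 : ℤ) m := ⟨by have := ha1.1; omega, by have := hb1.2; omega⟩
    have hgs := hg s hsm hsJ
    have hchain : IsChain (· ≤ ·) {x | ∃ j ∈ Set.Icc (-1 : ℤ) m,
        (j ≤ s ∧ x = F j) ∨ (s ≤ j ∧ x = g (F j))} := by
      have aux : ∀ i ∈ Set.Icc (-1 : ℤ) m, ∀ j ∈ Set.Icc (-1 : ℤ) m, i ≤ s → s ≤ j →
          F i ≤ g (F j) := fun i hi j hj h1 h2 =>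
        (C.F_le hi hsm h1).trans (hgs ▸ g.le_iff_le.2 (C.F_le hsm hj h2))
      rintro x ⟨i, hi, ⟨h1, rfl⟩ | ⟨h1, rfl⟩⟩ y ⟨j, hj, ⟨h2, rfl⟩ | ⟨h2, rfl⟩⟩ -
      · exact C.F_comp hi hj
      · exact Or.inl (aux i hi j hj h1 h2)
      · exact Or.inr (aux j hj i hi h2 h1)
      · exact (C.F_comp hi hj).imp g.le_iff_le.2 g.le_iff_le.2
    obtain ⟨h, hh⟩ := C.ext _ hchain
    have hlo : ∀ j ∈ Set.Icc (-1 : ℤ) m, j ≤ s → h (F j) = F j := fun j hj hjs => by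
      have := hh (F j) ⟨j, hj, Or.inl ⟨hjs, rfl⟩⟩
      rwa [C.hFrk j hj] at this
    have hhi : ∀ j ∈ Set.Icc (-1 : ℤ) m, s ≤ j → h (F j) = g (F j) := fun j hj hjs => by
      have := hh (g (F j)) ⟨j, hj, Or.inr ⟨hjs, rfl⟩⟩
      rwa [C.rk_aut, C.hFrk j hj] at this
    have e1 : h ∈ Subgroup.closure (ρ '' (J : Set ℤ)) := by
      refine mono (J.filter (s < ·)) (Finset.filter_ssubset.2 ⟨a, haJ, by omega⟩) h ?_
      intro j hj hjK
      by_cases hjs : j ≤ s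
      · exact hlo j hj hjs
      · rw [hhi j hj (by omega)]
        exact hg j hj (fun hjJ => hjK (Finset.mem_filter.2 ⟨hjJ, by omega⟩))
    have e2 : h⁻¹ * g ∈ Subgroup.closure (ρ '' (J : Set ℤ)) := by
      refine mono (J.filter (· < s)) (Finset.filter_ssubset.2 ⟨b, hbJ, by omega⟩) _ ?_
      intro j hj hjK
      rw [RelIso.mul_apply]
      by_cases hjs : s ≤ j
      · rw [← hhi j hj hjs]; exact h.symm_apply_apply _
      · rw [hg j hj (fun hjJ => hjK (Finset.mem_filter.2 ⟨hjJ, by omega⟩))]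
        exact fix_inv (hlo j hj (by omega))
    have := mul_mem e1 e2
    rwa [mul_inv_cancel_left] at this
  push Not at hs
  have hJm : ∀ s, s ∈ J ↔ a ≤ s ∧ s ≤ b := by
    intro s
    refine ⟨fun h => ⟨ha s h, hb s h⟩, fun ⟨h1, h2⟩ => ?_⟩
    rcases eq_or_lt_of_le h1 with rfl | h1
    · exact haJ
    rcases eq_or_lt_of_le h2 with rfl | h2
    · exact hbJ
    exact hs s h1 h2
  have h01 := ha1.1
  have h02 := ha1.2
  have h03 := hb1.1
  have h04 := hb1.2
  have m1 : a - 1 ∈ Set.Icc (-1 : ℤ) m := ⟨by omega, by omega⟩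
  have m0 : a ∈ Set.Icc (-1 : ℤ) m := ⟨by omega, by omega⟩
  have m2 : b + 1 ∈ Set.Icc (-1 : ℤ) m := ⟨by omega, by omega⟩
  have g1 := hg _ m1 (by rw [hJm]; omega)
  have g2 := hg _ m2 (by rw [hJm]; omega)
  rcases eq_or_lt_of_le hab with rfl | hab'
  · by_cases hga : g (F a) = F a
    · rw [C.rigid g (fun j hj => ?_)]
      · exact one_mem _
      · by_cases hja : j = a
        · rw [hja, hga]
        · exact hg j hj (by rw [hJm]; omega)
    · have c1 := C.between ha1 g g1 g2
      have c2 := C.between ha1 (ρ a) ((C.hρ a ha1).2 _ m1 (by omega))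
        ((C.hρ a ha1).2 _ m2 (by omega))
      have c3 : F (a - 1) < F a ∧ F a < F (a+1) := C.between ha1 1 rfl rfl
      have e := C.diam ha1 c3 c1 c2 (Ne.symm hga) (C.hρ a ha1).1.symm
      have : (ρ a)⁻¹ * g = 1 := C.rigid _ (fun j hj => by
        rw [RelIso.mul_apply]
        by_cases hja : j = a
        · rw [hja, e]; exact (ρ a).symm_apply_apply _
        · rw [hg j hj (by rw [hJm]; omega)]
          exact fix_inv ((C.hρ a ha1).2 j hj hja))
      rw [← inv_mul_eq_one.1 this]
      exact Subgroup.subset_closure ⟨a, haJ, rfl⟩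
  · have hconn := C.hK.strong_conn (F (a-1)) (F (b+1)) (C.F_le m1 m2 (by omega))
      (by rw [C.hFrk _ m1, C.hFrk _ m2]; omega)
    have p1 : F (a-1) < F a := C.F_lt m1 m0 (by omega)
    have p2 : F a < F (b+1) := C.F_lt m0 m2 (by omega)
    have path := hconn (F a) (g (F a)) p1 p2 (g1 ▸ g.lt_iff_lt.2 p1) (g2 ▸ g.lt_iff_lt.2 p2)
    have Q : ∃ h ∈ Subgroup.closure (ρ '' (J : Set ℤ)), h (F (rk (g (F a)))) = g (F a) := by
      generalize g (F a) = w at path ⊢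
      induction path with
      | refl => exact ⟨1, one_mem _, by rw [C.hFrk a m0]; rfl⟩
      | @tail x y _ hxy hx =>
        obtain ⟨h, hh, hhx⟩ := hx
        obtain ⟨x1, x2, y1, y2, hc⟩ := hxy
        have hfix := C.closure_fix J hJ h hh
        have f1 := fix_inv (hfix _ m1 (by rw [Finset.mem_coe, hJm]; omega))
        have f2 := fix_inv (hfix _ m2 (by rw [Finset.mem_coe, hJm]; omega))
        have rx := C.rk_mem x
        have hxx : h⁻¹ x = F (rk x) := by
          conv_lhs => rw [← hhx]
          exact h.symm_apply_apply _
        have x1' : F (a-1) < F (rk x) := by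
          rw [← hxx, ← f1]; exact h⁻¹.lt_iff_lt.2 x1
        have x2' : F (rk x) < F (b+1) := by
          rw [← hxx, ← f2]; exact h⁻¹.lt_iff_lt.2 x2
        have y1' : F (a-1) < h⁻¹ y := by
          rw [← f1]; exact h⁻¹.lt_iff_lt.2 y1
        have y2' : h⁻¹ y < F (b+1) := by
          rw [← f2]; exact h⁻¹.lt_iff_lt.2 y2
        have hc' : F (rk x) ≤ h⁻¹ y ∨ h⁻¹ y ≤ F (rk x) := by
          rw [← hxx]; exact hc.imp h⁻¹.le_iff_le.2 h⁻¹.le_iff_le.2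
        have rxJ : rk x ∈ J := by
          have t1 := C.hK.rk_strictMono _ _ x1
          have t2 := C.hK.rk_strictMono _ _ x2
          rw [C.hFrk _ m1] at t1
          rw [C.hFrk _ m2] at t2
          rw [hJm]; omega
        have hout : ∀ z, F (a-1) < z → z < F (b+1) → ∀ j ∈ Set.Icc (-1 : ℤ) m, j ∉ J →
            (F j ≤ z ∨ z ≤ F j) := by
          intro z z1 z2 j hj hjJ
          rw [hJm] at hjJ
          by_cases hja : j < a
          · exact Or.inl ((C.F_le hj m1 (by omega)).trans z1.le)
          · exact Or.inr (z2.le.trans (C.F_le m2 hj (by omega)))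
        have hchain : IsChain (· ≤ ·) {z | z = F (rk x) ∨ z = h⁻¹ y ∨
            ∃ j ∈ Set.Icc (-1 : ℤ) m, j ∉ J ∧ z = F j} := by
          rintro u (rfl | rfl | ⟨i, hi, hiJ, rfl⟩) v (rfl | rfl | ⟨j, hj, hjJ, rfl⟩) huv
          · exact absurd rfl huv
          · exact hc'
          · exact (hout _ x1' x2' j hj hjJ).symm
          · exact hc'.symm
          · exact absurd rfl huv
          · exact (hout _ y1' y2' j hj hjJ).symm
          · exact hout _ x1' x2' i hi hiJ
          · exact hout _ y1' y2' i hi hiJ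
          · exact C.F_comp hi hj
        obtain ⟨k, hk⟩ := C.ext _ hchain
        have hkJ : k ∈ Subgroup.closure (ρ '' (J : Set ℤ)) := by
          refine mono (J.erase (rk x)) (Finset.erase_ssubset rxJ) k (fun j hj hjK => ?_)
          by_cases hjx : j = rk x
          · have := hk (F (rk x)) (Or.inl rfl)
            rw [C.hFrk _ rx] at this
            rw [hjx, this]
          · have := hk (F j) (Or.inr (Or.inr ⟨j, hj,
              fun hjJ => hjK (Finset.mem_erase.2 ⟨hjx, hjJ⟩), rfl⟩))
            rwa [C.hFrk _ hj] at this
        refine ⟨h * k, mul_mem hh hkJ, ?_⟩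
        have := hk (h⁻¹ y) (Or.inr (Or.inl rfl))
        rw [C.rk_aut] at this
        rw [RelIso.mul_apply, this]
        exact h.apply_symm_apply _
    obtain ⟨h, hh, hha⟩ := Q
    rw [C.rk_aut, C.hFrk a m0] at hha
    have e2 : h⁻¹ * g ∈ Subgroup.closure (ρ '' (J : Set ℤ)) := by
      refine mono (J.erase a) (Finset.erase_ssubset haJ) _ (fun j hj hjK => ?_)
      rw [RelIso.mul_apply]
      by_cases hja : j = a
      · rw [hja, ← hha]; exact h.symm_apply_apply _
      · have hjJ : j ∉ J := fun hjJ => hjK (Finset.mem_erase.2 ⟨hja, hjJ⟩)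
        rw [hg j hj hjJ]
        exact fix_inv (C.closure_fix J hJ h hh j hj hjJ)
    have := mul_mem hh e2
    rwa [mul_inv_cancel_left] at this

theorem F_m (C : Ctx m rk F ρ) : F m = ⊤ :=
  C.eq_top (C.hFrk m ⟨by have := C.hm; omega, le_rfl⟩)

theorem F_bot (C : Ctx m rk F ρ) : F (-1) = ⊥ := by
  refine (C.eq_of_le bot_le ?_).symm
  rw [C.hK.rk_bot, C.hFrk (-1) ⟨le_rfl, by have := C.hm; omega⟩]

theorem skel_iff (C : Ctx m rk F ρ) {n : ℤ} (hn1 : 1 ≤ n) (hnm : n ≤ m) (e : ℤ) (J : Finset ℤ)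
    (hJ : (J : Set ℤ) ⊆ Set.Icc (0 : ℤ) (m - 1))
    (hJ' : ∀ j ∈ Set.Icc (-1 : ℤ) m, j ∉ J ↔ (j < n ∧ (j ≠ e ∨ j = -1)) ∨ j = m) :
    {g : α ≃o α | ∀ j ∈ Set.Icc (-1 : ℤ) n, j ≠ e →
        g (if j = n then (⊤ : α) else F j) = (if j = n then (⊤ : α) else F j)} =
      ↑(Subgroup.closure (ρ '' (J : Set ℤ))) := by
  ext g
  rw [Set.mem_setOf_eq, SetLike.mem_coe]
  constructor
  · intro h
    refine C.stab J hJ g (fun j hj hjJ => ?_)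
    rcases (hJ' j hj).1 hjJ with ⟨h1, h2 | h2⟩ | h1
    · have := h j ⟨hj.1, by omega⟩ h2
      rwa [if_neg (by omega)] at this
    · rw [h2, C.F_bot]; exact map_bot g
    · rw [h1, C.F_m]; exact map_top g
  · intro h j hj hje
    split_ifs with hjn
    · exact map_top g
    · have h1 := hj.1
      have h2 := hj.2
      have hj' : j ∈ Set.Icc (-1 : ℤ) m := ⟨h1, by omega⟩
      exact C.closure_fix J hJ g h j hj' ((hJ' j hj').2 (Or.inl ⟨by omega, Or.inl hje⟩))

theorem vert (C : Ctx m rk F ρ) {A x : α} (h : A < x) :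
    ∃ v, A < v ∧ v ≤ x ∧ rk v = rk A + 1 := by
  obtain ⟨k, hk⟩ := C.ext {A, x} (IsChain.pair h.le)
  have h1 := hk A (by simp)
  have h2 := hk x (by simp)
  have h3 := C.hK.rk_strictMono _ _ h
  have hA := C.rk_mem A
  have hx := C.rk_mem x
  have hA1 := hA.1
  have hx2 := hx.2
  have hm : rk A + 1 ∈ Set.Icc (-1 : ℤ) m := ⟨by omega, by omega⟩
  refine ⟨k (F (rk A + 1)), ?_, ?_, ?_⟩
  · conv_lhs => rw [← h1]
    exact k.lt_iff_lt.2 (C.F_lt hA hm (by omega))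
  · conv_rhs => rw [← h2]
    exact k.le_iff_le.2 (C.F_le hm hx (by omega))
  · rw [C.rk_aut, C.hFrk _ hm]

theorem conn_skel (C : Ctx m rk F ρ) {n : ℤ} (hnm : n ≤ m) (A : α)
    (hA : rk A ≤ n - 3) : ∀ (N : ℕ) (G : α), rk G ≤ N → A < G → n ≤ rk G →
    ∀ H K : {x : α // rk x ≤ n - 1 ∨ rk x = m}, A < H.1 → H.1 < G → A < K.1 → K.1 < G →
    Relation.ReflTransGen (fun a b : {x : α // rk x ≤ n - 1 ∨ rk x = m} =>
      A < a.1 ∧ rk a.1 ≤ n - 1 ∧ A < b.1 ∧ rk b.1 ≤ n - 1 ∧ (a ≤ b ∨ b ≤ a)) H K := by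
  intro N
  induction N with
  | zero =>
    intro G h1 h2 h3
    have := C.hK.rk_strictMono _ _ h2
    have := C.le_rk A
    push_cast at h1
    omega
  | succ N ih =>
    intro G h1 h2 h3 H K hH1 hH2 hK1 hK2
    have rkS : ∀ X : {x : α // rk x ≤ n - 1 ∨ rk x = m}, X.1 < G → rk X.1 ≤ n - 1 := by
      intro X hX
      have t1 := C.hK.rk_strictMono _ _ hX
      have t2 := C.rk_le G
      rcases X.2 with h | h <;> omega
    have path := C.hK.strong_conn A G h2.le (by omega) H.1 K.1 hH1 hH2 hK1 hK2
    have key : ∀ w, Relation.ReflTransGen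
      (fun a b => A < a ∧ a < G ∧ A < b ∧ b < G ∧ (a ≤ b ∨ b ≤ a)) H.1 w →
      ∀ v : {x : α // rk x ≤ n - 1 ∨ rk x = m}, A < v.1 → v.1 ≤ w → rk v.1 = rk A + 1 →
      Relation.ReflTransGen (fun a b : {x : α // rk x ≤ n - 1 ∨ rk x = m} =>
      A < a.1 ∧ rk a.1 ≤ n - 1 ∧ A < b.1 ∧ rk b.1 ≤ n - 1 ∧ (a ≤ b ∨ b ≤ a)) H v := by
      intro w hw
      induction hw with
      | refl =>
        intro v v1 v2 v3
        exact Relation.ReflTransGen.single ⟨hH1, rkS H hH2, v1, by omega, Or.inr v2⟩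
      | @tail x y _ hxy hx =>
        intro v v1 v2 v3
        obtain ⟨x1, x2, y1, y2, hc⟩ := hxy
        obtain ⟨u, u1, u2, u3⟩ := C.vert x1
        have hu := hx ⟨u, Or.inl (by omega)⟩ u1 u2 u3
        obtain ⟨z, z1, z2, xz, yz⟩ : ∃ z, A < z ∧ z < G ∧ x ≤ z ∧ y ≤ z := by
          rcases hc with h | h
          · exact ⟨y, y1, y2, h, le_rfl⟩
          · exact ⟨x, x1, x2, le_rfl, h⟩
        refine hu.trans ?_
        by_cases hz : rk z ≤ n - 1
        · exact (Relation.ReflTransGen.single (b := (⟨z, Or.inl hz⟩ :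
              {x : α // rk x ≤ n - 1 ∨ rk x = m}))
            ⟨u1, (by omega : rk u ≤ n - 1), z1, hz, Or.inl (u2.trans xz)⟩).tail
            ⟨z1, hz, v1, by omega, Or.inr (v2.trans yz)⟩
        · have t := C.hK.rk_strictMono _ _ z2
          push_cast at h1
          exact ih z (by omega) z1 (by omega) _ _ u1
            (C.lt_of_comp (Or.inl (u2.trans xz)) (by show rk u < rk z; omega)) v1
            (C.lt_of_comp (Or.inl (v2.trans yz)) (by omega))
    obtain ⟨v, v1, v2, v3⟩ := C.vert hK1
    exact (key K.1 path ⟨v, Or.inl (by omega)⟩ v1 v2 v3).tail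
      ⟨v1, (by omega : rk v ≤ n - 1), hK1, rkS K hK2, Or.inl v2⟩

/-- the part of a translate of the base flag in the skeleton -/
def T (m n : ℤ) (rk : α → ℤ) (F : ℤ → α) (h : α ≃o α) :
    Set {x : α // rk x ≤ n - 1 ∨ rk x = m} := {x | h (F (rk x.1)) = x.1}

theorem T_mem (C : Ctx m rk F ρ) {n : ℤ} (h : α ≃o α) (i : ℤ) (hi : i ∈ Set.Icc (-1 : ℤ) m)
    (hi' : i ≤ n - 1 ∨ i = m) :
    ∃ y ∈ T m n rk F h, rk y.1 = i := by
  have e : rk (h (F i)) = i := by rw [C.rk_aut, C.hFrk i hi]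
  exact ⟨⟨h (F i), by rw [e]; exact hi'⟩, by
    change h (F (rk (h (F i)))) = h (F i)
    rw [e], e⟩

theorem T_chain (C : Ctx m rk F ρ) {n : ℤ} (h : α ≃o α) : IsChain (· ≤ ·) (T m n rk F h) := by
  intro x hx y hy _
  have : x.1 ≤ y.1 ∨ y.1 ≤ x.1 := by
    rw [← show h (F (rk x.1)) = x.1 from hx, ← show h (F (rk y.1)) = y.1 from hy]
    exact (C.F_comp (C.rk_mem _) (C.rk_mem _)).imp h.le_iff_le.2 h.le_iff_le.2
  exact this

theorem T_flag (C : Ctx m rk F ρ) {n : ℤ} (h : α ≃o α) :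
    IsFlagOf Set.univ (T m n rk F h) := by
  refine ⟨Set.subset_univ _, C.T_chain h, fun Ψ _ hΨ hs => ?_⟩
  refine Set.Subset.antisymm (fun x hx => ?_) hs
  obtain ⟨y, hy, e⟩ := C.T_mem (n := n) h (rk x.1) (C.rk_mem _) x.2
  have : y = x := Subtype.ext (C.eq_of_comp (hΨ.total (hs hy) hx) e)
  exact this ▸ hy

theorem T_ext (C : Ctx m rk F ρ) {n : ℤ} (c : Set {x : α // rk x ≤ n - 1 ∨ rk x = m})
    (hc : IsChain (· ≤ ·) c) : ∃ h : α ≃o α, c ⊆ T m n rk F h := by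
  have : IsChain (· ≤ ·) (Subtype.val '' c) := by
    rintro _ ⟨x, hx, rfl⟩ _ ⟨y, hy, rfl⟩ _
    exact hc.total hx hy
  obtain ⟨h, hh⟩ := C.ext _ this
  exact ⟨h, fun x hx => hh x.1 ⟨x, hx, rfl⟩⟩

theorem flag_T (C : Ctx m rk F ρ) {n : ℤ} (Φ : Set {x : α // rk x ≤ n - 1 ∨ rk x = m})
    (hΦ : IsFlagOf Set.univ Φ) : ∃ h : α ≃o α, Φ = T m n rk F h := by
  obtain ⟨h, hh⟩ := C.T_ext Φ hΦ.2.1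
  exact ⟨h, (hΦ.2.2 _ (Set.subset_univ _) (C.T_chain h) hh).symm⟩

theorem T_rk (C : Ctx m rk F ρ) {n : ℤ} (hn1 : 1 ≤ n) (hnm : n ≤ m) (h : α ≃o α) (i : ℤ)
    (hi : i ∈ Set.Icc (-1 : ℤ) n) :
    ∃ y ∈ T m n rk F h, (if rk y.1 = m then n else rk y.1) = i := by
  have h1 := hi.1
  have h2 := hi.2
  by_cases hin : i = n
  · obtain ⟨y, hy, e⟩ := C.T_mem (n := n) h m ⟨by omega, le_rfl⟩ (Or.inr rfl)
    exact ⟨y, hy, by rw [if_pos e, hin]⟩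
  · obtain ⟨y, hy, e⟩ := C.T_mem (n := n) h i ⟨by omega, by omega⟩ (Or.inl (by omega))
    exact ⟨y, hy, by rw [if_neg (by omega), e]⟩

theorem T_card (C : Ctx m rk F ρ) {n : ℤ} (hn1 : 1 ≤ n) (hnm : n ≤ m) (h : α ≃o α) :
    (T m n rk F h).ncard = (n + 2).toNat := by
  have himg : (fun y : {x : α // rk x ≤ n - 1 ∨ rk x = m} => if rk y.1 = m then n else rk y.1) ''
      (T m n rk F h) = Set.Icc (-1 : ℤ) n := by
    ext i
    constructor
    · rintro ⟨y, hy, rfl⟩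
      have := C.le_rk y.1
      have := y.2
      simp only [Set.mem_Icc]
      split_ifs <;> omega
    · exact C.T_rk hn1 hnm h i
  rw [← Set.ncard_image_of_injOn (f := fun y : {x : α // rk x ≤ n - 1 ∨ rk x = m} =>
    if rk y.1 = m then n else rk y.1), himg]
  · rw [Set.ncard_eq_toFinset_card', Set.toFinset_Icc, Int.card_Icc]
    congr 1
    ring
  · intro x hx y hy hxy
    simp only at hxy
    have e : rk x.1 = rk y.1 := by
      have := x.2
      have := y.2
      split_ifs at hxy <;> omega
    exact Subtype.ext (C.eq_of_comp ((C.T_chain h).total hx hy) e)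

theorem skel_inc (C : Ctx m rk F ρ) {n : ℤ} (hn1 : 1 ≤ n) (hnm : n ≤ m) :
    @IncComplex {x : α // rk x ≤ n - 1 ∨ rk x = m} _
        (SkelBO rk n m C.hK.rk_bot C.hK.rk_top hn1) n
        (fun x => if rk x.1 = m then n else rk x.1) := by
  letI := SkelBO rk n m C.hK.rk_bot C.hK.rk_top hn1
  have hm := C.hm
  refine ⟨?_, ?_, ?_, ?_, ?_, ?_, ?_⟩
  · change (if rk (⊥ : α) = m then n else rk (⊥ : α)) = -1
    rw [C.hK.rk_bot, if_neg (by omega)]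
  · change (if rk (⊤ : α) = m then n else rk (⊤ : α)) = n
    rw [C.hK.rk_top, if_pos rfl]
  · intro x y hxy
    have h1 := C.hK.rk_strictMono x.1 y.1 hxy
    have h2 := C.rk_le y.1
    have := x.2
    have := y.2
    split_ifs <;> omega
  · intro c hc
    obtain ⟨h, hh⟩ := C.T_ext c hc
    exact ⟨_, hh, C.T_flag h, C.T_card hn1 hnm h⟩
  · intro Φ hΦ i hi
    obtain ⟨h, rfl⟩ := C.flag_T Φ hΦ
    exact C.T_rk hn1 hnm h i hi
  · intro A G hAG hrk H K hH1 hH2 hK1 hK2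
    have hA := C.le_rk A.1
    have hA2 := A.2
    have hG2 := G.2
    have hlt : A.1 < G.1 := (hH1.trans hH2 : A < G)
    have hr := C.hK.rk_strictMono _ _ hlt
    have hGm := C.rk_le G.1
    rw [if_neg (by omega : ¬ rk A.1 = m)] at hrk
    by_cases hG : rk G.1 = m
    · rw [if_pos hG] at hrk
      have := C.conn_skel hnm A.1 (by omega) (rk G.1).toNat G.1 (by omega) hlt (by omega)
        H K hH1 hH2 hK1 hK2
      have hGt := C.eq_top hG
      have ltG : ∀ x : {x : α // rk x ≤ n - 1 ∨ rk x = m}, rk x.1 ≤ n - 1 → x < G := by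
        intro x hx
        have : x.1 < G.1 := C.lt_of_comp (Or.inl (hGt ▸ le_top)) (by omega)
        exact this
      exact Relation.ReflTransGen.mono (fun a b ⟨a1, a2, b1, b2, hc⟩ => ⟨a1, ltG a a2, b1, ltG b b2, hc⟩) _ _ this
    · rw [if_neg hG] at hrk
      have path := C.hK.strong_conn A.1 G.1 hAG (by omega) H.1 K.1 hH1 hH2 hK1 hK2
      have key : ∀ w, Relation.ReflTransGen
          (fun a b => A.1 < a ∧ a < G.1 ∧ A.1 < b ∧ b < G.1 ∧ (a ≤ b ∨ b ≤ a)) H.1 w →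
          ∀ hw : rk w ≤ n - 1 ∨ rk w = m, Relation.ReflTransGen
          (fun a b => A < a ∧ a < G ∧ A < b ∧ b < G ∧ (a ≤ b ∨ b ≤ a)) H ⟨w, hw⟩ := by
        intro w hw
        induction hw with
        | refl => intro _; exact Relation.ReflTransGen.refl
        | @tail x y _ hxy hx =>
          intro hy
          have t := C.hK.rk_strictMono _ _ hxy.2.1
          exact (hx (Or.inl (by omega))).tail hxy
      exact key K.1 path K.2
  · intro A G hAG hrk
    have hA2 := A.2
    have hG2 := G.2
    have hlt : A.1 < G.1 := hAG
    have hr := C.hK.rk_strictMono _ _ hlt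
    have hGm := C.rk_le G.1
    rw [if_neg (by omega : ¬ rk A.1 = m)] at hrk
    have hA := C.le_rk A.1
    by_cases hG : rk G.1 = m
    · rw [if_pos hG] at hrk
      obtain ⟨y, hy, hc⟩ := C.exists_rk A.1 n ⟨by omega, hnm⟩
      have hAy : A.1 < y := C.lt_of_comp hc (by omega)
      obtain ⟨H, H', hne, a1, a2, b1, b2⟩ := C.hK.two_between _ _ hAy (by omega)
      have t1 := C.hK.rk_strictMono _ _ a2
      have t2 := C.hK.rk_strictMono _ _ b2
      have yG : y ≤ G.1 := C.eq_top hG ▸ le_top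
      exact ⟨⟨H, Or.inl (by omega)⟩, ⟨H', Or.inl (by omega)⟩, fun e => hne (congrArg Subtype.val e),
        a1, a2.trans_le yG, b1, b2.trans_le yG⟩
    · rw [if_neg hG] at hrk
      obtain ⟨H, H', hne, a1, a2, b1, b2⟩ := C.hK.two_between _ _ hlt (by omega)
      have t1 := C.hK.rk_strictMono _ _ a2
      have t2 := C.hK.rk_strictMono _ _ b2
      exact ⟨⟨H, Or.inl (by omega)⟩, ⟨H', Or.inl (by omega)⟩, fun e => hne (congrArg Subtype.val e),
        a1, a2, b1, b2⟩

end Ctx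

/-- the `(n-1)`-skeleton of an abstract regular `m`-polytope `L`
is a regular polytope complex of rank `n` on which `Γ = Aut(L)` acts
flag-transitively, with distinguished generating subgroups
`R_{-1} = R_n = ⟨ρ_n,…,ρ_{m-1}⟩`, `R_i = ⟨ρ_i,ρ_n,…,ρ_{m-1}⟩` for `i ≤ n-2`,
and `R_{n-1} = ⟨ρ_{n-1},ρ_n,…,ρ_{m-1}⟩`. -/
theorem skeleton_is_regular_polytope_complex
    {α : Type*} [PartialOrder α] [BoundedOrder α] (m : ℤ) (rk : α → ℤ)
    (hm : 1 ≤ m) (hK : IncComplex α m rk)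
    (hdiamond : ∀ A B : α, A < B → rk B = rk A + 2 →
      {H : α | A < H ∧ H < B}.ncard = 2)
    (hreg : IsRegularIC α)
    (F : ℤ → α) (hFflag : IsFlagOf Set.univ (F '' Set.Icc (-1 : ℤ) m))
    (hFrk : ∀ i ∈ Set.Icc (-1 : ℤ) m, rk (F i) = i)
    (ρ : ℤ → (α ≃o α))
    (hρ : ∀ i ∈ Set.Icc (0 : ℤ) (m - 1), ρ i (F i) ≠ F i ∧
      ∀ j ∈ Set.Icc (-1 : ℤ) m, j ≠ i → ρ i (F j) = F j)
    (hgen : Subgroup.closure (ρ '' Set.Icc (0 : ℤ) (m - 1)) =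
      (⊤ : Subgroup (α ≃o α)))
    (n : ℤ) (hn1 : 1 ≤ n) (hnm : n ≤ m) :
    (@IncComplex {x : α // rk x ≤ n - 1 ∨ rk x = m} _
        (SkelBO rk n m hK.rk_bot hK.rk_top hn1) n
        (fun x => if rk x.1 = m then n else rk x.1)) ∧
    (∀ A B : {x : α // rk x ≤ n - 1 ∨ rk x = m}, A < B →
      (if rk B.1 = m then n else rk B.1) =
        (if rk A.1 = m then n else rk A.1) + 2 →
      (if rk B.1 = m then n else rk B.1) ≤ n - 1 →
      {H : {x : α // rk x ≤ n - 1 ∨ rk x = m} | A < H ∧ H < B}.ncard = 2) ∧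
    (∀ Φ Ψ : Set {x : α // rk x ≤ n - 1 ∨ rk x = m},
      IsFlagOf Set.univ Φ → IsFlagOf Set.univ Ψ →
      ∃ g : α ≃o α, ⇑g '' (Subtype.val '' Φ) = Subtype.val '' Ψ) ∧
    (∀ i ∈ Set.Icc (0 : ℤ) (n - 1),
      {g : α ≃o α | ∀ j ∈ Set.Icc (-1 : ℤ) n, j ≠ i →
          g (if j = n then (⊤ : α) else F j) = (if j = n then (⊤ : α) else F j)} =
        ↑(Subgroup.closure ({ρ i} ∪ ρ '' Set.Icc n (m - 1)))) ∧
    {g : α ≃o α | ∀ j ∈ Set.Icc (-1 : ℤ) n, j ≠ -1 →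
        g (if j = n then (⊤ : α) else F j) = (if j = n then (⊤ : α) else F j)} =
      ↑(Subgroup.closure (ρ '' Set.Icc n (m - 1))) ∧
    {g : α ≃o α | ∀ j ∈ Set.Icc (-1 : ℤ) n, j ≠ n →
        g (if j = n then (⊤ : α) else F j) = (if j = n then (⊤ : α) else F j)} =
      ↑(Subgroup.closure (ρ '' Set.Icc n (m - 1))) := by
  have C : Ctx m rk F ρ := ⟨hm, hK, hdiamond, hreg, hFflag, hFrk, hρ, hgen⟩
  refine ⟨C.skel_inc hn1 hnm, ?_, ?_, ?_, ?_, ?_⟩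
  · intro A B hAB hrk hBn
    have hlt : A.1 < B.1 := hAB
    have hr := hK.rk_strictMono _ _ hlt
    have hBm := C.rk_le B.1
    have hB : ¬ rk B.1 = m := fun e => by rw [if_pos e] at hBn; omega
    rw [if_neg hB] at hrk hBn
    rw [if_neg (by omega)] at hrk
    rw [← hdiamond A.1 B.1 hlt hrk, ← Set.ncard_image_of_injective _ Subtype.val_injective]
    congr 1
    ext x
    constructor
    · rintro ⟨y, ⟨h1, h2⟩, rfl⟩
      exact ⟨h1, h2⟩
    · rintro ⟨h1, h2⟩
      have := hK.rk_strictMono _ _ h2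
      exact ⟨⟨x, Or.inl (by omega)⟩, ⟨h1, h2⟩, rfl⟩
  · intro Φ Ψ hΦ hΨ
    obtain ⟨h, rfl⟩ := C.flag_T Φ hΦ
    obtain ⟨k, rfl⟩ := C.flag_T Ψ hΨ
    have key : ∀ (h k : α ≃o α) (x : {x : α // rk x ≤ n - 1 ∨ rk x = m}),
        x ∈ Ctx.T m n rk F h → ∃ y ∈ Ctx.T m n rk F k, y.1 = k (h.symm x.1) := by
      intro h k x hx
      have hx' : h (F (rk x.1)) = x.1 := hx
      have e : h.symm x.1 = F (rk x.1) := by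
        conv_lhs => rw [← hx']
        exact h.symm_apply_apply _
      obtain ⟨y, hy, e'⟩ := C.T_mem (n := n) k (rk x.1) (C.rk_mem _) x.2
      refine ⟨y, hy, ?_⟩
      rw [e, ← e']
      exact (show k (F (rk y.1)) = y.1 from hy).symm
    refine ⟨h.symm.trans k, ?_⟩
    ext z
    constructor
    · rintro ⟨_, ⟨x, hx, rfl⟩, rfl⟩
      obtain ⟨y, hy, e⟩ := key h k x hx
      exact ⟨y, hy, e⟩
    · rintro ⟨y, hy, rfl⟩
      obtain ⟨x, hx, e⟩ := key k h y hy
      refine ⟨x.1, ⟨x, hx, rfl⟩, ?_⟩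
      rw [e]
      simp
  · intro i hi
    have h1 := hi.1
    have h2 := hi.2
    have := C.skel_iff hn1 hnm i (insert i (Finset.Icc n (m - 1)))
      (by intro j hj
          simp only [Finset.coe_insert, Finset.coe_Icc, Set.mem_insert_iff, Set.mem_Icc] at hj ⊢
          omega)
      (by intro j hj
          simp only [Finset.mem_insert, Finset.mem_Icc, Set.mem_Icc] at hj ⊢
          omega)
    rw [this, Finset.coe_insert, Finset.coe_Icc, Set.image_insert_eq, Set.insert_eq]
  · have := C.skel_iff hn1 hnm (-1) (Finset.Icc n (m - 1))
      (by intro j hj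
          simp only [Finset.coe_Icc, Set.mem_Icc] at hj ⊢
          omega)
      (by intro j hj
          simp only [Finset.mem_Icc, Set.mem_Icc] at hj ⊢
          omega)
    rw [this, Finset.coe_Icc]
  · have := C.skel_iff hn1 hnm n (Finset.Icc n (m - 1))
      (by intro j hj
          simp only [Finset.coe_Icc, Set.mem_Icc] at hj ⊢
          omega)
      (by intro j hj
          simp only [Finset.mem_Icc, Set.mem_Icc] at hj ⊢
          omega)
    rw [this, Finset.coe_Icc]
end
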